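/- Suppose I and J are squarefree monomial ideals. Then I + J ⊂ R has a constant depth function (i.e., depth R/(I+J)^n is the same for all n ≥ 1) if and only if I and J each have a constant depth function (i.e., depth A/I^n is constant in n ≥ 1 and depth B/J^n is constant in n ≥ 1). -/

import Mathlib

/-! Core definitions: depth via local cohomology at the maximal homogeneous ideal,
Castelnuovo–Mumford regularity via graded free resolutions, gradings on
subquotients of polynomial rings.  -/

open MvPolynomial

noncomputable section

namespace PaperHTT

variable (k : Type) [Field k]

/-- A polynomial is homogeneous of degree `e : ℤ` (it must vanish in negative degrees). -/
def homogZ {σ : Type} (p : MvPolynomial σ k) (e : ℤ) : Prop :=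
  p = 0 ∨ (0 ≤ e ∧ p.IsHomogeneous e.toNat)

/-- The maximal homogeneous ideal `(x_1, …, x_r)` of a polynomial ring. -/
def maxHomIdeal (σ : Type) : Ideal (MvPolynomial σ k) :=
  Ideal.span (Set.range MvPolynomial.X)

/-- The depth of a module over a polynomial ring with respect to the maximal homogeneous
ideal: the least `i` such that the `i`-th local cohomology is non-vanishing. -/
def depthM {σ : Type} (M : ModuleCat (MvPolynomial σ k)) : ℕ :=
  sInf {i : ℕ | Nontrivial ((localCohomology (maxHomIdeal k σ) i).obj M)}

/-- The subquotient `p/q` of a polynomial ring, for ideals `q ≤ p`. -/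
abbrev subQuot {σ : Type} (p q : Ideal (MvPolynomial σ k)) : Type :=
  ↥p ⧸ (Submodule.comap p.subtype q)

/-- The degree-`t` graded piece of `p/q`: the image of the homogeneous elements of
degree `t` of `p`. -/
def subQuotGr {σ : Type} (p q : Ideal (MvPolynomial σ k)) (t : ℤ) :
    AddSubgroup (subQuot k p q) :=
  AddSubgroup.closure
    {x | ∃ f : p, homogZ k (f : MvPolynomial σ k) t ∧ x = Submodule.Quotient.mk f}

/-- The degree-`t` graded piece of the quotient ring `P/Q`. -/
def quotGr {σ : Type} (Q : Ideal (MvPolynomial σ k)) (t : ℤ) :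
    AddSubgroup (MvPolynomial σ k ⧸ Q) :=
  AddSubgroup.closure {x | ∃ f, homogZ k f t ∧ x = Ideal.Quotient.mk Q f}

/-- The degree-`t` graded piece of an ideal `p`, viewed as a module. -/
def idealGr {σ : Type} (p : Ideal (MvPolynomial σ k)) (t : ℤ) : AddSubgroup ↥p :=
  AddSubgroup.closure {x : p | homogZ k (x : MvPolynomial σ k) t}

/-- A finite graded free resolution of a module `M` over a polynomial ring,
with respect to a grading `gr` of `M`: `F_i` is free of rank `rk i`, with basis elements
of (twisted) degrees `tw i l`, the differentials and augmentation are graded of degree `0`,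
and the complex `⋯ → F_1 → F_0 → M → 0` is exact. -/
structure GradedFreeRes (σ : Type) (M : Type) [AddCommGroup M]
    [Module (MvPolynomial σ k) M] (gr : ℤ → AddSubgroup M) where
  rk : ℕ → ℕ
  tw : (i : ℕ) → Fin (rk i) → ℤ
  bdd : ∃ N, ∀ i, N ≤ i → rk i = 0
  aug : (Fin (rk 0) → MvPolynomial σ k) →ₗ[MvPolynomial σ k] M
  d : (i : ℕ) →
    ((Fin (rk (i + 1)) → MvPolynomial σ k) →ₗ[MvPolynomial σ k]
      (Fin (rk i) → MvPolynomial σ k))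
  aug_surj : Function.Surjective aug
  exact_zero : LinearMap.range (d 0) = LinearMap.ker aug
  exact_succ : ∀ i, LinearMap.range (d (i + 1)) = LinearMap.ker (d i)
  aug_homog : ∀ l, aug (Pi.single l 1) ∈ gr (tw 0 l)
  d_homog : ∀ i l l', homogZ k (d i (Pi.single l 1) l') (tw (i + 1) l - tw i l')

/-- The Castelnuovo–Mumford regularity of a (finitely generated) graded module over a
polynomial ring: the least `r` such that `M` admits a graded free resolution with all
twists in homological degree `i` at most `r + i`.  (By minimal free resolutions, this
agrees with `max {aⁱ(M) + i}`.) -/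
def regM (σ : Type) (M : Type) [AddCommGroup M] [Module (MvPolynomial σ k) M]
    (gr : ℤ → AddSubgroup M) : ℤ :=
  sInf {r : ℤ | ∃ F : GradedFreeRes k σ M gr, ∀ i (l : Fin (F.rk i)), F.tw i l - (i : ℤ) ≤ r}

/-- Depth of the quotient ring `P/Q` as a module over `P`. -/
def depthQuot {σ : Type} (Q : Ideal (MvPolynomial σ k)) : ℕ :=
  depthM k (ModuleCat.of (MvPolynomial σ k) (MvPolynomial σ k ⧸ Q))

/-- Depth of the subquotient `p/q` as a module over the polynomial ring. -/
def depthSubQuot {σ : Type} (p q : Ideal (MvPolynomial σ k)) : ℕ :=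
  depthM k (ModuleCat.of (MvPolynomial σ k) (subQuot k p q))

/-- Depth of an ideal `p` as a module over the polynomial ring. -/
def depthIdeal {σ : Type} (p : Ideal (MvPolynomial σ k)) : ℕ :=
  depthM k (ModuleCat.of (MvPolynomial σ k) ↥p)

/-- Regularity of the quotient ring `P/Q`. -/
def regQuot {σ : Type} (Q : Ideal (MvPolynomial σ k)) : ℤ :=
  regM k σ (MvPolynomial σ k ⧸ Q) (quotGr k Q)

/-- Regularity of the subquotient `p/q`. -/
def regSubQuot {σ : Type} (p q : Ideal (MvPolynomial σ k)) : ℤ :=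
  regM k σ (subQuot k p q) (subQuotGr k p q)

/-- Regularity of an ideal `p`, viewed as a graded module. -/
def regIdeal {σ : Type} (p : Ideal (MvPolynomial σ k)) : ℤ :=
  regM k σ (↥p) (idealGr k p)

/-- A homogeneous ideal: one containing all homogeneous components of its elements. -/
def IsHomogeneousIdeal {σ : Type} (I : Ideal (MvPolynomial σ k)) : Prop :=
  ∀ f ∈ I, ∀ m : ℕ, MvPolynomial.homogeneousComponent m f ∈ I

/-- A monomial ideal. -/
def IsMonomialIdeal {σ : Type} (I : Ideal (MvPolynomial σ k)) : Prop :=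
  ∃ S : Set (σ →₀ ℕ), I = Ideal.span ((fun a => MvPolynomial.monomial a (1 : k)) '' S)

/-- A squarefree monomial ideal. -/
def IsSquarefreeMonomialIdeal {σ : Type} (I : Ideal (MvPolynomial σ k)) : Prop :=
  ∃ S : Set (σ →₀ ℕ), (∀ a ∈ S, ∀ x, a x ≤ 1) ∧
    I = Ideal.span ((fun a => MvPolynomial.monomial a (1 : k)) '' S)


/-- The quotient ring `P/Q` is Cohen–Macaulay: its depth equals its Krull dimension. -/
def IsCMQuot {σ : Type} (Q : Ideal (MvPolynomial σ k)) : Prop :=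
  (depthQuot k Q : WithBot (WithTop ℕ)) = ringKrullDim (MvPolynomial σ k ⧸ Q)

/-- An isomorphism of graded modules: a linear isomorphism matching up the gradings. -/
def GradedIso {P : Type} [CommRing P] {M N : Type} [AddCommGroup M] [Module P M]
    [AddCommGroup N] [Module P N] (grM : ℤ → AddSubgroup M) (grN : ℤ → AddSubgroup N) :
    Prop :=
  ∃ e : M ≃ₗ[P] N, ∀ t, (grM t).map e.toLinearMap.toAddMonoidHom = grN t

/-- `gr` is an (internal, ℤ-) grading of the module `M` over a polynomial ring,
compatible with the standard grading of the polynomial ring. -/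
def IsGrading (σ : Type) {M : Type} [AddCommGroup M] [Module (MvPolynomial σ k) M]
    (gr : ℤ → AddSubgroup M) : Prop :=
  DirectSum.IsInternal (fun t : ℤ => gr t) ∧
    ∀ (p : MvPolynomial σ k) (d : ℕ) (t : ℤ) (m : M), p.IsHomogeneous d → m ∈ gr t →
      p • m ∈ gr (t + d)

/-- The polynomial ring `A = k[x_1,…,x_r]`. -/
abbrev PA (r : ℕ) : Type := MvPolynomial (Fin r) k

/-- The polynomial ring `B = k[y_1,…,y_s]`. -/
abbrev PB (s : ℕ) : Type := MvPolynomial (Fin s) k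

/-- The polynomial ring `R = k[x_1,…,x_r,y_1,…,y_s]`. -/
abbrev PR (r s : ℕ) : Type := MvPolynomial (Fin r ⊕ Fin s) k

/-- The extension of an ideal `I ⊆ A` to `R`. -/
def extA {r s : ℕ} (I : Ideal (PA k r)) : Ideal (PR k r s) :=
  I.map (MvPolynomial.rename (Sum.inl : Fin r → Fin r ⊕ Fin s))

/-- The extension of an ideal `J ⊆ B` to `R`. -/
def extB {r s : ℕ} (J : Ideal (PB k s)) : Ideal (PR k r s) :=
  J.map (MvPolynomial.rename (Sum.inr : Fin s → Fin r ⊕ Fin s))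

/-- The ideal `I + J ⊆ R`. -/
def sumIJ {r s : ℕ} (I : Ideal (PA k r)) (J : Ideal (PB k s)) : Ideal (PR k r s) :=
  extA k I + extB k J

end PaperHTT

end

section ExtComparison

open CategoryTheory Limits

universe u

variable {R : Type u} [CommRing R]

namespace CochainComplex

/-- The cochain `x` is a cocycle representing the cohomology class `z`. -/
def Represents (K : CochainComplex (ModuleCat.{u} R) ℕ) (n : ℕ) (x : K.X n)
    (z : K.homology n) : Prop :=
  ∃ c : K.cycles n, K.iCycles n c = x ∧ K.homologyπ n c = z

variable {K L : CochainComplex (ModuleCat.{u} R) ℕ} {n : ℕ}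

lemma exists_represents (z : K.homology n) : ∃ x, K.Represents n x z := by
  obtain ⟨c, hc⟩ := (ModuleCat.epi_iff_surjective (K.homologyπ n)).1 inferInstance z
  exact ⟨_, c, rfl, hc⟩

lemma Represents.d_eq_zero {x : K.X n} {z : K.homology n} (h : K.Represents n x z) (m : ℕ) :
    K.d n m x = 0 := by
  obtain ⟨c, rfl, -⟩ := h
  exact congrArg (fun f => f.hom c) (K.iCycles_d n m)

lemma Represents.map {x : K.X n} {z : K.homology n} (h : K.Represents n x z) (φ : K ⟶ L) :
    L.Represents n (φ.f n x) (HomologicalComplex.homologyMap φ n z) := by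
  obtain ⟨c, rfl, rfl⟩ := h
  refine ⟨HomologicalComplex.cyclesMap φ n c, ?_, ?_⟩
  · exact congrArg (fun f => f.hom c) (HomologicalComplex.cyclesMap_i φ n)
  · exact congrArg (fun f => f.hom c) (HomologicalComplex.homologyπ_naturality φ n).symm

lemma Represents.eq_zero_iff {x : K.X n} {z : K.homology n} (h : K.Represents n x z) :
    z = 0 ↔ ∃ y : K.X ((ComplexShape.up ℕ).prev n), K.d _ n y = x := by
  obtain ⟨c, rfl, rfl⟩ := h
  have ex := (ShortComplex.moduleCat_exact_iff _).1
    (ShortComplex.exact_of_g_is_cokernel (S := ShortComplex.mk _ _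
      (K.toCycles_comp_homologyπ ((ComplexShape.up ℕ).prev n) n))
    (K.homologyIsCokernel _ n rfl))
  have hi : ∀ y, K.iCycles n (K.toCycles ((ComplexShape.up ℕ).prev n) n y) = K.d _ n y := by
    intro y
    exact congrArg (fun f => f.hom y) (K.toCycles_i ((ComplexShape.up ℕ).prev n) n)
  constructor
  · intro hz
    obtain ⟨y, hy⟩ := ex c hz
    exact ⟨y, by rw [← hi]; exact congrArg _ hy⟩
  · rintro ⟨y, hy⟩
    rw [← hi] at hy
    have := (ModuleCat.mono_iff_injective (K.iCycles n)).1 inferInstance hy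
    rw [← this]
    exact congrArg (fun f => f.hom y)
      (K.toCycles_comp_homologyπ ((ComplexShape.up ℕ).prev n) n)

end CochainComplex

namespace CategoryTheory

lemma inv_square_of_hom_square {C : Type*} [Category* C] {X Y X' Y' : C} {e : X ≅ Y} {e' : X' ≅ Y'}
    {f : Y ⟶ Y'} {g : X ⟶ X'} (h : e.hom ≫ f = g ≫ e'.hom) : f ≫ e'.inv = e.inv ≫ g := by
  rw [Iso.comp_inv_eq, Category.assoc, ← h, Iso.inv_hom_id_assoc]

lemma paste_squares {C : Type*} [Category* C] {X Y Z X' Y' Z' : C} {p : X ⟶ Y} {r : Y ⟶ Z}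
    {q : X' ⟶ Y'} {s : Y' ⟶ Z'} {a : X' ⟶ X} {b : Y' ⟶ Y} {c : Z' ⟶ Z}
    (h : a ≫ p = q ≫ b) (h' : b ≫ r = s ≫ c) : a ≫ p ≫ r = (q ≫ s) ≫ c := by
  rw [← Category.assoc, h, Category.assoc, h', Category.assoc]

end CategoryTheory

namespace CategoryTheory.ProjectiveResolution

variable {X X' Y : ModuleCat.{u} R} (P : ProjectiveResolution X)

/-- A cocycle defines the zero class in `Abelian.Ext` exactly when it is a coboundary. -/
lemma extMk_eq_zero_iff_prev {n : ℕ} (f : P.complex.X n ⟶ Y) (hf : P.complex.d (n + 1) n ≫ f = 0) :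
    P.extMk f (n + 1) rfl hf = 0 ↔
      ∃ g : P.complex.X ((ComplexShape.up ℕ).prev n) ⟶ Y, P.complex.d n _ ≫ g = f := by
  cases n with
  | succ p =>
    rw [CochainComplex.prev_nat_succ]
    exact P.extMk_eq_zero_iff f _ _ hf p rfl
  | zero =>
    rw [CochainComplex.prev_nat_zero, P.complex.shape 0 0 (by simp)]
    simp only [zero_comp, exists_const]
    constructor
    · intro h
      rw [← P.extEquivCohomologyClass.apply_eq_iff_eq, extEquivCohomologyClass_extMk,
        extEquivCohomologyClass_zero, CochainComplex.HomComplex.CohomologyClass.mk_eq_zero_iff,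
        CochainComplex.HomComplex.Cocycle.toSingleMk_mem_coboundaries_iff _ _ _ _ _ 1 (by simp)]
        at h
      obtain ⟨g, hg⟩ := h
      have h1 : P.cochainComplex.d (-(0 : ℕ)) 1 = 0 := by
        exact (CochainComplex.isZero_of_isStrictlyLE _ 0 _).eq_of_tgt _ _
      rw [h1, zero_comp] at hg
      exact ((cancel_epi _).1 (hg.symm.trans comp_zero.symm)).symm
    · rintro rfl
      exact P.extMk_zero _ _

/-- The map induced by a chain map on the complexes computing `Ext`. -/
noncomputable def linearYonedaObjMap {P : ProjectiveResolution X} {P' : ProjectiveResolution X'}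
    (φ : P.complex ⟶ P'.complex) (Y : ModuleCat.{u} R) :
    P'.complex.linearYonedaObj R Y ⟶ P.complex.linearYonedaObj R Y :=
  (HomologicalComplex.unopFunctor _ _).map
    ((((linearYoneda R (ModuleCat.{u} R)).obj Y).rightOp.mapHomologicalComplex _).map φ).op

lemma homologyUnop_inv_naturality {ι : Type*} {c : ComplexShape ι}
    {K L : HomologicalComplex (ModuleCat.{u} R)ᵒᵖ c} (ψ : K ⟶ L) (i : ι) :
    (HomologicalComplex.homologyMap ψ i).unop ≫ (K.homologyUnop i).inv =
      (L.homologyUnop i).inv ≫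
        HomologicalComplex.homologyMap ((HomologicalComplex.unopFunctor _ _).map ψ.op) i := by
  have h := congrArg Quiver.Hom.unop (HomologicalComplex.homologyOp_hom_naturality
    ((HomologicalComplex.unopFunctor _ _).map ψ.op) i)
  change (L.homologyUnop i).hom ≫ (HomologicalComplex.homologyMap ψ i).unop =
    HomologicalComplex.homologyMap ((HomologicalComplex.unopFunctor _ _).map ψ.op) i ≫
      (K.homologyUnop i).hom at h
  exact inv_square_of_hom_square h

lemma isoExt_naturality {P : ProjectiveResolution X} {P' : ProjectiveResolution X'} {g : X ⟶ X'}
    (φ : P.complex ⟶ P'.complex) (comm : φ.f 0 ≫ P'.π.f 0 = P.π.f 0 ≫ g) (n : ℕ) :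
    ((_root_.Ext R (ModuleCat.{u} R) n).map g.op).app Y ≫ (P.isoExt (R := R) n Y).hom =
      (P'.isoExt (R := R) n Y).hom ≫
        HomologicalComplex.homologyMap (linearYonedaObjMap φ Y) n := by
  have h := congrArg Quiver.Hom.unop (isoLeftDerivedObj_inv_naturality g P P' φ comm
    ((linearYoneda R (ModuleCat.{u} R)).obj Y).rightOp n)
  have h' := homologyUnop_inv_naturality
    ((((linearYoneda R (ModuleCat.{u} R)).obj Y).rightOp.mapHomologicalComplex _).map φ) n
  exact paste_squares h h'

end CategoryTheory.ProjectiveResolution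

namespace CochainComplex

lemma exists_represents_of_d_eq_zero {K : CochainComplex (ModuleCat.{u} R) ℕ} {n : ℕ} (x : K.X n)
    (hx : K.d n (n + 1) x = 0) : ∃ z, K.Represents n x z := by
  have ex := (ShortComplex.moduleCat_exact_iff _).1
    (ShortComplex.exact_of_f_is_kernel (S := ShortComplex.mk _ _ (K.iCycles_d n (n + 1)))
    (K.cyclesIsKernel n _ (by simp)))
  obtain ⟨c, hc⟩ := ex x hx
  exact ⟨_, c, hc, rfl⟩

end CochainComplex

namespace CategoryTheory.ProjectiveResolution

variable {X X' Y : ModuleCat.{u} R} (P : ProjectiveResolution X)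

/-- The cocycle `f` represents the element `z` of the derived functor `Ext`. -/
def ExtRepresents {n : ℕ} (f : P.complex.X n ⟶ Y)
    (z : ((_root_.Ext R (ModuleCat.{u} R) n).obj (Opposite.op X)).obj Y) : Prop :=
  (P.complex.linearYonedaObj R Y).Represents n f ((P.isoExt (R := R) n Y).hom z)

variable {P} {n : ℕ}

lemma exists_extRepresents (P : ProjectiveResolution X)
    (z : ((_root_.Ext R (ModuleCat.{u} R) n).obj (Opposite.op X)).obj Y) :
    ∃ f : P.complex.X n ⟶ Y, P.ExtRepresents f z :=
  CochainComplex.exists_represents (K := P.complex.linearYonedaObj R Y)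
    ((P.isoExt (R := R) n Y).hom z)

lemma exists_extRepresents_of_d_eq_zero (f : P.complex.X n ⟶ Y)
    (hf : P.complex.d (n + 1) n ≫ f = 0) : ∃ z, P.ExtRepresents f z := by
  obtain ⟨z, hz⟩ := CochainComplex.exists_represents_of_d_eq_zero
    (K := P.complex.linearYonedaObj R Y) f hf
  obtain ⟨w, rfl⟩ := (P.isoExt (R := R) n Y).toLinearEquiv.surjective z
  exact ⟨w, hz⟩

lemma ExtRepresents.d_comp {f : P.complex.X n ⟶ Y}
    {z : ((_root_.Ext R (ModuleCat.{u} R) n).obj (Opposite.op X)).obj Y}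
    (h : P.ExtRepresents f z) : P.complex.d (n + 1) n ≫ f = 0 :=
  CochainComplex.Represents.d_eq_zero h (n + 1)

lemma ExtRepresents.eq_zero_iff {f : P.complex.X n ⟶ Y}
    {z : ((_root_.Ext R (ModuleCat.{u} R) n).obj (Opposite.op X)).obj Y}
    (h : P.ExtRepresents f z) : z = 0 ↔ P.extMk f (n + 1) rfl h.d_comp = 0 := by
  rw [extMk_eq_zero_iff_prev, ← (P.isoExt (R := R) n Y).toLinearEquiv.map_eq_zero_iff]
  exact CochainComplex.Represents.eq_zero_iff h

lemma ExtRepresents.map {P' : ProjectiveResolution X'} {f : P'.complex.X n ⟶ Y}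
    {z : ((_root_.Ext R (ModuleCat.{u} R) n).obj (Opposite.op X')).obj Y}
    (h : P'.ExtRepresents f z) {g : X ⟶ X'} (φ : P.complex ⟶ P'.complex)
    (comm : φ.f 0 ≫ P'.π.f 0 = P.π.f 0 ≫ g) :
    P.ExtRepresents (φ.f n ≫ f)
      (((_root_.Ext R (ModuleCat.{u} R) n).map g.op).app Y z) := by
  have h1 := CochainComplex.Represents.map h (linearYonedaObjMap φ Y)
  have h2 := congrArg (fun t => t.hom z) (isoExt_naturality (Y := Y) φ comm n)
  unfold ExtRepresents
  exact (congrArg (CochainComplex.Represents _ n (φ.f n ≫ f)) h2).mpr h1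

end CategoryTheory.ProjectiveResolution

variable {X X' Y : ModuleCat.{u} R} {n : ℕ}

lemma subsingleton_ext_iff_subsingleton_abelianExt :
    Subsingleton (((_root_.Ext R (ModuleCat.{u} R) n).obj (Opposite.op X)).obj Y) ↔
      Subsingleton (Abelian.Ext.{u} X Y n) := by
  let P := projectiveResolution X
  constructor
  · intro h
    refine subsingleton_of_forall_eq 0 fun e => ?_
    obtain ⟨f, hf, rfl⟩ := P.extMk_surjective e (n + 1) rfl
    obtain ⟨z, hz⟩ := ProjectiveResolution.exists_extRepresents_of_d_eq_zero f hf
    exact hz.eq_zero_iff.1 (Subsingleton.elim _ _)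
  · intro h
    refine subsingleton_of_forall_eq 0 fun z => ?_
    obtain ⟨f, hf⟩ := ProjectiveResolution.exists_extRepresents P z
    exact hf.eq_zero_iff.2 (Subsingleton.elim _ _)

/-- If precomposition with `g` is injective on `Abelian.Ext`, it is injective on the derived
functor `Ext`. -/
lemma ext_map_injective (g : X ⟶ X')
    (hg : ∀ e : Abelian.Ext.{u} X' Y n, (Abelian.Ext.mk₀ g).comp e (zero_add n) = 0 → e = 0) :
    Function.Injective (((_root_.Ext R (ModuleCat.{u} R) n).map g.op).app Y) := by
  let P := projectiveResolution X
  let P' := projectiveResolution X'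
  rw [injective_iff_map_eq_zero]
  intro z hz
  obtain ⟨f, hf⟩ := ProjectiveResolution.exists_extRepresents P' z
  let φ : ProjectiveResolution.Hom P P' g :=
    ⟨ProjectiveResolution.lift g P P', ProjectiveResolution.lift_commutes_zero g P P'⟩
  have hm := hf.map φ.hom (by simpa using φ.hom_f_zero_comp_π_f_zero)
  rw [hf.eq_zero_iff]
  apply hg
  rw [ProjectiveResolution.mk₀_comp_extMk _ _ _ _ φ]
  exact hm.eq_zero_iff.1 hz

end ExtComparison

section LocalCohomologyDepth

open CategoryTheory Limits

variable {R : Type} [CommRing R] (J : Ideal R)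

/-- The modules `Ext^j(R/J, M)` vanish for `j < d`. -/
def ExtVanishing (M : Type) [AddCommGroup M] [Module R M] (d : ℕ) : Prop :=
  ∀ j < d, Subsingleton (Abelian.Ext.{0} (ModuleCat.of R (R ⧸ J)) (ModuleCat.of R M) j)

variable {J} {M : Type} [AddCommGroup M] [Module R M]

lemma ExtVanishing.mono {d e : ℕ} (h : ExtVanishing J M d) (hed : e ≤ d) : ExtVanishing J M e :=
  fun j hj => h j (hj.trans_le hed)

lemma support_subset_of_pow_smul_eq_zero {N : Type} [AddCommGroup N] [Module R N] (t : ℕ)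
    (hN : ∀ a ∈ J ^ t, ∀ x : N, a • x = 0) :
    Module.support R N ⊆ PrimeSpectrum.zeroLocus (J : Set R) := by
  intro p hp
  rw [Module.mem_support_iff_exists_annihilator] at hp
  obtain ⟨x, hx⟩ := hp
  refine fun a ha => p.2.mem_of_pow_mem t (hx ?_)
  rw [Submodule.mem_annihilator_span_singleton]
  exact hN _ (Ideal.pow_mem_pow ha t) x

lemma support_quotient_pow (t : ℕ) :
    Module.support R (R ⧸ J ^ t) ⊆ PrimeSpectrum.zeroLocus (J : Set R) := by
  refine support_subset_of_pow_smul_eq_zero t fun a ha x => ?_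
  obtain ⟨x, rfl⟩ := Ideal.Quotient.mk_surjective x
  rw [← Ideal.Quotient.mk_eq_mk, ← Submodule.Quotient.mk_smul]
  exact (Submodule.Quotient.mk_eq_zero _).2 (Ideal.mul_mem_right _ _ ha)

variable [IsNoetherianRing R] [Module.Finite R M]

lemma ExtVanishing.subsingleton_ext (hJ : J • (⊤ : Submodule R M) ≠ ⊤) {d : ℕ}
    (h : ExtVanishing J M d) (N : ModuleCat.{0} R) [Module.Finite R N]
    (hN : Module.support R N ⊆ PrimeSpectrum.zeroLocus (J : Set R)) :
    ∀ j < d, Subsingleton (Abelian.Ext.{0} N (ModuleCat.of R M) j) := by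
  obtain ⟨rs, rfl, hmem, hreg⟩ := ModuleCat.exists_isRegular_of_exists_subsingleton_ext J d
    (ModuleCat.of R M) hJ.lt_top (ModuleCat.of R (R ⧸ J))
    (by rw [Module.support_eq_zeroLocus, Ideal.annihilator_quotient]) h
  exact ModuleCat.subsingleton_ext_of_exists_isRegular J N hN (ModuleCat.of R M) hJ.lt_top rs
    hmem hreg

/-- Precomposition with a surjection of modules supported on `V(J)` is injective on `Ext` in the
first degree where `Ext^j(R/J, M)` may be nonzero. -/
lemma ExtVanishing.mk₀_comp_injective (hJ : J • (⊤ : Submodule R M) ≠ ⊤) {d : ℕ}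
    (h : ExtVanishing J M d) {N N' : ModuleCat.{0} R} [Module.Finite R N]
    (hN : Module.support R N ⊆ PrimeSpectrum.zeroLocus (J : Set R)) (g : N ⟶ N')
    (hg : Function.Surjective g) (e : Abelian.Ext.{0} N' (ModuleCat.of R M) d)
    (he : (Abelian.Ext.mk₀ g).comp e (zero_add d) = 0) : e = 0 := by
  let S : ShortComplex (ModuleCat.{0} R) :=
    ShortComplex.mk (ModuleCat.ofHom (LinearMap.ker g.hom).subtype) g (by ext x; exact x.2)
  have hS : S.ShortExact :=
    { exact := by
        rw [ShortComplex.moduleCat_exact_iff]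
        exact fun x hx => ⟨⟨x, hx⟩, rfl⟩
      mono_f := (ModuleCat.mono_iff_injective _).2 (Submodule.subtype_injective _)
      epi_g := (ModuleCat.epi_iff_surjective _).2 hg }
  cases d with
  | zero =>
    obtain ⟨f, rfl⟩ := Abelian.Ext.homEquiv₀.symm.surjective e
    have : Epi g := hS.epi_g
    simp only [Abelian.Ext.homEquiv₀_symm_apply, Abelian.Ext.mk₀_comp_mk₀,
      Abelian.Ext.mk₀_eq_zero_iff] at he ⊢
    exact (cancel_epi g).1 (he.trans comp_zero.symm)
  | succ d =>
    obtain ⟨x, rfl⟩ := Abelian.Ext.contravariant_sequence_exact₃ hS _ e he (add_comm 1 d)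
    have : IsNoetherian R N := isNoetherian_of_isNoetherianRing_of_finite R N
    have : Module.Finite R S.X₁ := inferInstanceAs (Module.Finite R (LinearMap.ker g.hom))
    have := h.subsingleton_ext hJ S.X₁
      ((Module.support_subset_of_injective (LinearMap.ker g.hom).subtype
        (Submodule.subtype_injective _)).trans hN) d (Nat.lt_succ_self d)
    rw [Subsingleton.elim x 0, Abelian.Ext.comp_zero]

lemma localCohomology_subsingleton (hJ : J • (⊤ : Submodule R M) ≠ ⊤) {d j : ℕ}
    (h : ExtVanishing J M d) (hj : j < d) :
    Subsingleton ((localCohomology J j).obj (ModuleCat.of R M)) := by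
  let hc := isColimitOfPreserves ((evaluation _ _).obj (ModuleCat.of R M))
    (colimit.isColimit (localCohomology.diagram (localCohomology.idealPowersDiagram J) j))
  refine subsingleton_of_forall_eq 0 fun z => ?_
  obtain ⟨t, x, hx⟩ := Concrete.isColimit_exists_rep _ hc z
  have : Subsingleton (((localCohomology.diagram (localCohomology.idealPowersDiagram J) j).obj
      t).obj (ModuleCat.of R M)) := by
    refine subsingleton_ext_iff_subsingleton_abelianExt.2 ?_
    exact h.subsingleton_ext hJ (ModuleCat.of R (R ⧸ J ^ t.unop.unop))
      (support_quotient_pow t.unop.unop) j hj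
  rw [← hx]
  exact (congrArg _ (this.elim x 0)).trans (map_zero _)

lemma localCohomology_nontrivial (hJ : J • (⊤ : Submodule R M) ≠ ⊤) {d : ℕ}
    (h : ExtVanishing J M d) (h' : ¬ ExtVanishing J M (d + 1)) :
    Nontrivial ((localCohomology J d).obj (ModuleCat.of R M)) := by
  let hc := isColimitOfPreserves ((evaluation _ _).obj (ModuleCat.of R M))
    (colimit.isColimit (localCohomology.diagram (localCohomology.idealPowersDiagram J) d))
  let t : ℕᵒᵖᵒᵖ := Opposite.op (Opposite.op 1)
  have hle : J ^ 1 ≤ J := (pow_one J).le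
  have hnt : ¬ Subsingleton (((localCohomology.diagram (localCohomology.idealPowersDiagram J) d).obj
      t).obj (ModuleCat.of R M)) := by
    intro hs
    have hs' : Subsingleton (Abelian.Ext.{0} (ModuleCat.of R (R ⧸ J ^ 1)) (ModuleCat.of R M) d) :=
      subsingleton_ext_iff_subsingleton_abelianExt.1 hs
    refine h' fun j hj => ?_
    obtain hj | rfl := Nat.lt_succ_iff_lt_or_eq.1 hj
    · exact h j hj
    refine subsingleton_of_forall_eq 0 fun e => ?_
    exact h.mk₀_comp_injective hJ (N := ModuleCat.of R (R ⧸ J ^ 1)) (support_quotient_pow 1)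
      (ModuleCat.ofHom (Submodule.factor hle)) (Submodule.factor_surjective hle) e
      (Subsingleton.elim _ _)
  obtain ⟨x, hx⟩ : ∃ x : ((localCohomology.diagram (localCohomology.idealPowersDiagram J) d).obj
      t).obj (ModuleCat.of R M), x ≠ 0 := by
    by_contra! hall
    exact hnt (subsingleton_of_forall_eq 0 hall)
  refine nontrivial_of_ne ((((evaluation _ _).obj (ModuleCat.of R M)).mapCocone
    (colimit.cocone (localCohomology.diagram (localCohomology.idealPowersDiagram J) d))).ι.app t x)
    0 fun h0 => ?_
  obtain ⟨s, f, g, hfg⟩ := (Concrete.isColimit_rep_eq_iff_exists _ hc x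
    (0 : ((localCohomology.diagram (localCohomology.idealPowersDiagram J) d).obj
      t).obj (ModuleCat.of R M))).1 (h0.trans (map_zero _).symm)
  refine hx (ext_map_injective
    ((localCohomology.ringModIdeals (localCohomology.idealPowersDiagram J)).map f.unop)
    (fun e he => ?_) (hfg.trans ((map_zero _).trans (map_zero _).symm)))
  refine h.mk₀_comp_injective hJ (N := ModuleCat.of R (R ⧸ J ^ s.unop.unop))
    (support_quotient_pow _) _ ?_ e he
  exact Submodule.factor_surjective (Ideal.pow_le_pow_right f.unop.unop.down.down)

lemma depthM_eq {k : Type} [Field k] {σ : Type} [Finite σ] {M : Type} [AddCommGroup M]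
    [Module (MvPolynomial σ k) M] [Module.Finite (MvPolynomial σ k) M]
    (hM : PaperHTT.maxHomIdeal k σ • (⊤ : Submodule (MvPolynomial σ k) M) ≠ ⊤) {d : ℕ}
    (h : ExtVanishing (PaperHTT.maxHomIdeal k σ) M d)
    (h' : ¬ ExtVanishing (PaperHTT.maxHomIdeal k σ) M (d + 1)) :
    PaperHTT.depthM k (ModuleCat.of (MvPolynomial σ k) M) = d := by
  apply IsLeast.csInf_eq
  refine ⟨localCohomology_nontrivial hM h h', fun j hj => ?_⟩
  by_contra! hlt
  exact not_subsingleton_iff_nontrivial.2 hj (localCohomology_subsingleton hM h hlt)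

end LocalCohomologyDepth

section ExtVanishingProperties

open CategoryTheory Limits

variable {R : Type} [CommRing R] {J : Ideal R}
  {M M' M'' : Type} [AddCommGroup M] [Module R M] [AddCommGroup M'] [Module R M']
  [AddCommGroup M''] [Module R M'']

lemma ExtVanishing.of_retract {d : ℕ} (h : ExtVanishing J M d) (i : M' →ₗ[R] M) (p : M →ₗ[R] M')
    (hpi : ∀ x, p (i x) = x) : ExtVanishing J M' d := by
  intro j hj
  refine subsingleton_of_forall_eq 0 fun e => ?_
  have h0 : e.comp (Abelian.Ext.mk₀ (ModuleCat.ofHom i)) (add_zero j) = 0 :=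
    (h j hj).elim _ _
  have h1 : ModuleCat.ofHom i ≫ ModuleCat.ofHom p = 𝟙 (ModuleCat.of R M') := by
    ext x
    exact hpi x
  rw [← Abelian.Ext.comp_mk₀_id e, ← h1, ← Abelian.Ext.mk₀_comp_mk₀,
    ← Abelian.Ext.comp_assoc_of_second_deg_zero, h0, Abelian.Ext.zero_comp]

lemma ExtVanishing.of_equiv {d : ℕ} (h : ExtVanishing J M d) (e : M ≃ₗ[R] M') :
    ExtVanishing J M' d :=
  h.of_retract e.symm.toLinearMap e.toLinearMap e.apply_symm_apply

lemma ExtVanishing.of_subsingleton [Subsingleton M] (d : ℕ) : ExtVanishing J M d := by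
  intro j _
  refine subsingleton_of_forall_eq 0 fun e => ?_
  have h0 : 𝟙 (ModuleCat.of R M) = 0 := by
    ext x
    exact Subsingleton.elim (α := M) _ _
  rw [← Abelian.Ext.comp_mk₀_id e, h0, Abelian.Ext.mk₀_zero, Abelian.Ext.comp_zero]

lemma shortExact_of_linearMap {f : M' →ₗ[R] M} {g : M →ₗ[R] M''} (hf : Function.Injective f)
    (hg : Function.Surjective g) (hfg : Function.Exact f g) :
    (ShortComplex.mk (ModuleCat.ofHom f) (ModuleCat.ofHom g)
      (by ext x; exact hfg.apply_apply_eq_zero x)).ShortExact where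
  exact := by
    rw [ShortComplex.moduleCat_exact_iff]
    exact fun x hx => (hfg x).1 hx
  mono_f := (ModuleCat.mono_iff_injective _).2 hf
  epi_g := (ModuleCat.epi_iff_surjective _).2 hg

lemma ExtVanishing.middle {d : ℕ} {f : M' →ₗ[R] M} {g : M →ₗ[R] M''} (hf : Function.Injective f)
    (hg : Function.Surjective g) (hfg : Function.Exact f g) (h' : ExtVanishing J M' d)
    (h'' : ExtVanishing J M'' d) : ExtVanishing J M d := by
  intro j hj
  refine subsingleton_of_forall_eq 0 fun e => ?_
  obtain ⟨e', rfl⟩ := Abelian.Ext.covariant_sequence_exact₂ _ (shortExact_of_linearMap hf hg hfg) e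
    ((h'' j hj).elim _ _)
  rw [(h' j hj).elim e' 0, Abelian.Ext.zero_comp]

lemma ExtVanishing.left {d : ℕ} {f : M' →ₗ[R] M} {g : M →ₗ[R] M''} (hf : Function.Injective f)
    (hg : Function.Surjective g) (hfg : Function.Exact f g) (h : ExtVanishing J M (d + 1))
    (h'' : ExtVanishing J M'' d) : ExtVanishing J M' (d + 1) := by
  intro j hj
  refine subsingleton_of_forall_eq 0 fun e => ?_
  have h0 : e.comp (Abelian.Ext.mk₀ (ModuleCat.ofHom f)) (add_zero j) = 0 :=
    (h j hj).elim _ _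
  cases j with
  | zero =>
    have : Mono (ModuleCat.ofHom f) := (ModuleCat.mono_iff_injective _).2 hf
    exact Abelian.Ext.postcomp_mk₀_injective_of_mono _ (ModuleCat.ofHom f)
      (h0.trans (Abelian.Ext.zero_comp _ _ _ _ (add_zero 0)).symm)
  | succ j =>
    obtain ⟨q, rfl⟩ := Abelian.Ext.covariant_sequence_exact₁ _
      (shortExact_of_linearMap hf hg hfg) e h0 rfl
    rw [(h'' j (by omega)).elim q 0, Abelian.Ext.zero_comp]

end ExtVanishingProperties

section RegularSequenceDepth

open CategoryTheory Limits Pointwise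

/-- There is an `M`-regular sequence of length `d` in `J` modulo which some nonzero element is
killed by `J`. -/
def RegDepth {R : Type} [CommRing R] (J : Ideal R) :
    ℕ → ∀ (M : Type) [AddCommGroup M] [Module R M], Prop
  | 0, M, _, _ => ∃ v : M, v ≠ 0 ∧ ∀ a ∈ J, a • v = 0
  | d + 1, M, _, _ => ∃ x ∈ J, IsSMulRegular M x ∧ RegDepth J d (QuotSMulTop x M)

variable {R : Type} [CommRing R] {J : Ideal R}

lemma RegDepth.extVanishing {d : ℕ} {M : Type} [AddCommGroup M] [Module R M]
    (h : RegDepth J d M) : ExtVanishing J M d ∧ ¬ ExtVanishing J M (d + 1) := by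
  induction d generalizing M with
  | zero =>
    obtain ⟨v, hv, hJ⟩ := h
    refine ⟨fun j hj => absurd hj (Nat.not_lt_zero j), fun hs => ?_⟩
    have := hs 0 Nat.one_pos
    have h1 : Subsingleton (ModuleCat.of R (R ⧸ J) ⟶ ModuleCat.of R M) :=
      Abelian.Ext.addEquiv₀.symm.subsingleton
    let f : (R ⧸ J) →ₗ[R] M := Submodule.liftQ J (LinearMap.toSpanSingleton R M v)
      fun a ha => hJ a ha
    have h2 := congrArg (fun g => g.hom (Submodule.Quotient.mk 1)) (h1.elim (ModuleCat.ofHom f) 0)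
    have h3 : (1 : R) • v = 0 := h2
    exact hv (by rwa [one_smul] at h3)
  | succ d ih =>
    obtain ⟨x, hx, hreg, hq⟩ := h
    obtain ⟨h1, h2⟩ := ih hq
    have hS := hreg.smulShortComplex_shortExact (M := ModuleCat.of R M)
    have hzero : ∀ j (e : Abelian.Ext.{0} (ModuleCat.of R (R ⧸ J)) (ModuleCat.of R M) j),
        e.comp (Abelian.Ext.mk₀ (ModuleCat.smulShortComplex (ModuleCat.of R M) x).f)
          (add_zero j) = 0 := fun j e => by
      have hann : x ∈ Module.annihilator R (ModuleCat.of R (R ⧸ J)) := by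
        change x ∈ Module.annihilator R (R ⧸ J)
        rwa [Ideal.annihilator_quotient]
      exact DFunLike.congr_fun (congrArg AddCommGrpCat.Hom.hom <|
        Abelian.Ext.postcomp_smul_id_eq_zero_of_mem_annihilator (M := ModuleCat.of R M) hann j) e
    have hM : ExtVanishing J M (d + 1) := by
      intro j hj
      refine subsingleton_of_forall_eq 0 fun e => ?_
      cases j with
      | zero =>
        exact Abelian.Ext.postcomp_mk₀_injective_of_mono _ _ (hf := hS.mono_f)
          ((hzero 0 e).trans (Abelian.Ext.zero_comp _ _ _ _ (add_zero 0)).symm)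
      | succ j =>
        obtain ⟨q, rfl⟩ := Abelian.Ext.covariant_sequence_exact₁ _ hS e (hzero _ e) rfl
        have hq0 : q = 0 := (h1 j (by omega)).elim q 0
        subst hq0
        exact Abelian.Ext.zero_comp _ _ _ _ _
    refine ⟨hM, fun hM' => h2 fun j hj => ?_⟩
    obtain hj | rfl := Nat.lt_succ_iff_lt_or_eq.1 hj
    · exact h1 j hj
    refine subsingleton_of_forall_eq 0 fun q => ?_
    obtain ⟨m, rfl⟩ := Abelian.Ext.covariant_sequence_exact₃ _ hS q rfl
      ((hM' (j + 1) (by omega)).elim _ _)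
    have hm0 : m = 0 := (hM j (by omega)).elim m 0
    subst hm0
    exact Abelian.Ext.zero_comp _ _ _ _ _

lemma RegDepth.unique {d e : ℕ} {M : Type} [AddCommGroup M] [Module R M]
    (h : RegDepth J d M) (h' : RegDepth J e M) : d = e := by
  refine le_antisymm ?_ ?_ <;> by_contra! hlt
  · exact h'.extVanishing.2 (h.extVanishing.1.mono hlt)
  · exact h.extVanishing.2 (h'.extVanishing.1.mono hlt)

lemma exists_socle_of_pow {M : Type} [AddCommGroup M] [Module R M] (t : ℕ) {w : M} (hw : w ≠ 0)
    (h : ∀ a ∈ J ^ t, a • w = 0) : ∃ v : M, v ≠ 0 ∧ ∀ a ∈ J, a • v = 0 := by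
  induction t generalizing w with
  | zero => exact absurd (by simpa using h 1 (by simp)) hw
  | succ t ih =>
    by_cases ht : ∀ a ∈ J ^ t, a • w = 0
    · exact ih hw ht
    · push Not at ht
      obtain ⟨a, ha, haw⟩ := ht
      refine ⟨a • w, haw, fun b hb => ?_⟩
      rw [smul_smul, mul_comm]
      exact h _ (by rw [pow_succ]; exact Ideal.mul_mem_mul ha hb)

/-- The map induced on quotients `M/xM` by a semilinear map. -/
def quotSMulTopMap {R' : Type} [CommRing R'] {φ : R →+* R'} {M N : Type} [AddCommGroup M]
    [Module R M] [AddCommGroup N] [Module R' N] (e : M →ₛₗ[φ] N) (x : R) :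
    QuotSMulTop x M →ₛₗ[φ] QuotSMulTop (φ x) N :=
  Submodule.mapQ _ _ e (by
    rintro m hm
    obtain ⟨m, -, rfl⟩ := (Submodule.mem_smul_pointwise_iff_exists _ _ _).1 hm
    rw [Submodule.mem_comap, map_smulₛₗ]
    exact Submodule.smul_mem_pointwise_smul _ _ _ trivial)

lemma quotSMulTopMap_bijective {R' : Type} [CommRing R'] {φ : R →+* R'} {M N : Type}
    [AddCommGroup M] [Module R M] [AddCommGroup N] [Module R' N] {e : M →ₛₗ[φ] N}
    (he : Function.Bijective e) (x : R) : Function.Bijective (quotSMulTopMap e x) := by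
  constructor
  · rw [injective_iff_map_eq_zero]
    intro m hm
    obtain ⟨m, rfl⟩ := Submodule.Quotient.mk_surjective _ m
    obtain ⟨n, -, hn⟩ := (Submodule.mem_smul_pointwise_iff_exists _ _ _).1
      ((Submodule.Quotient.mk_eq_zero _).1 hm)
    obtain ⟨n, rfl⟩ := he.2 n
    rw [← map_smulₛₗ] at hn
    rw [← he.1 hn]
    exact (Submodule.Quotient.mk_eq_zero _).2 (Submodule.smul_mem_pointwise_smul _ _ _ trivial)
  · intro n
    obtain ⟨n, rfl⟩ := Submodule.Quotient.mk_surjective _ n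
    obtain ⟨m, rfl⟩ := he.2 n
    exact ⟨Submodule.Quotient.mk m, rfl⟩

/-- Regular-sequence depth is preserved along a semilinear bijection over a ring map `φ` for which
`J` and the ideal generated by `φ(J)` have the same radical. -/
lemma RegDepth.of_semilinear {R' : Type} [CommRing R'] {J' : Ideal R'} {φ : R →+* R'} {t : ℕ}
    (hφ : J.map φ ≤ J') (ht : J' ^ t ≤ J.map φ) {d : ℕ} {M N : Type} [AddCommGroup M] [Module R M]
    [AddCommGroup N] [Module R' N] (e : M →ₛₗ[φ] N) (he : Function.Bijective e)
    (h : RegDepth J d M) : RegDepth J' d N := by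
  induction d generalizing M N with
  | zero =>
    obtain ⟨v, hv, hJ⟩ := h
    refine exists_socle_of_pow t (w := e v) (fun h0 => hv (he.1 (h0.trans (map_zero e).symm))) ?_
    have hle : J.map φ ≤ (R' ∙ e v).annihilator := by
      rw [Ideal.map_le_iff_le_comap]
      intro a ha
      rw [Ideal.mem_comap, Submodule.mem_annihilator_span_singleton, ← map_smulₛₗ, hJ a ha,
        map_zero]
    exact fun a ha => (Submodule.mem_annihilator_span_singleton _ _).1 (hle (ht ha))
  | succ d ih =>
    obtain ⟨x, hx, hreg, hq⟩ := h
    refine ⟨φ x, hφ (Ideal.mem_map_of_mem φ hx), ?_, ih (quotSMulTopMap e x)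
      (quotSMulTopMap_bijective he x) hq⟩
    intro n n' hn
    obtain ⟨m, rfl⟩ := he.2 n
    obtain ⟨m', rfl⟩ := he.2 n'
    simp only [← map_smulₛₗ] at hn
    exact congrArg e (hreg (he.1 hn))

lemma RegDepth.of_equiv {d : ℕ} {M N : Type} [AddCommGroup M] [Module R M]
    [AddCommGroup N] [Module R N] (h : RegDepth J d M) (e : M ≃ₗ[R] N) : RegDepth J d N :=
  h.of_semilinear (φ := RingHom.id R) (J' := J) (t := 1) (by simp [Ideal.map_id]) (by simp)
    e.toLinearMap e.bijective

lemma smul_top_quotSMulTop_ne_top {M : Type*} [AddCommGroup M]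
    [Module R M] {r : R} (hr : r ∈ J) (hJ : J • (⊤ : Submodule R M) ≠ ⊤) :
    J • (⊤ : Submodule R (QuotSMulTop r M)) ≠ ⊤ := by
  by_contra eq
  absurd congrArg (Submodule.comap (Submodule.mkQ _)) eq
  simpa [Submodule.comap_smul_top_of_surjective J _ (Submodule.mkQ_surjective _),
    Submodule.smul_mono_left ((Ideal.span_singleton_le_iff_mem J).mpr hr),
    ← Submodule.ideal_span_singleton_smul] using hJ

lemma exists_regDepth_quotient [IsNoetherianRing R] {M : Type} [AddCommGroup M]
    [Module R M] [Module.Finite R M] (P : Submodule R M)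
    (hP : J • (⊤ : Submodule R (M ⧸ P)) ≠ ⊤) : ∃ d, RegDepth J d (M ⧸ P) := by
  have : IsNoetherian R M := isNoetherian_of_isNoetherianRing_of_finite R M
  induction P using WellFoundedGT.induction with
  | ind P ih =>
  by_cases hs : Subsingleton ((R ⧸ J) →ₗ[R] (M ⧸ P))
  · obtain ⟨x, hx, hreg⟩ := IsSMulRegular.subsingleton_linearMap_iff.1 hs
    rw [Ideal.annihilator_quotient] at hx
    let g : M →ₗ[R] QuotSMulTop x (M ⧸ P) := (Submodule.mkQ _).comp P.mkQ
    let e := g.quotKerEquivOfSurjective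
      ((Submodule.mkQ_surjective _).comp (Submodule.mkQ_surjective _))
    have hne : J • (⊤ : Submodule R (M ⧸ LinearMap.ker g)) ≠ ⊤ := by
      intro htop
      refine smul_top_quotSMulTop_ne_top hx hP ?_
      have := congrArg (Submodule.map e.toLinearMap) htop
      simpa [Submodule.map_smul''] using this
    have hlt : P < LinearMap.ker g := by
      refine lt_of_le_of_ne (fun p hp => ?_) fun heq => ?_
      · change Submodule.Quotient.mk (P.mkQ p) = 0
        rw [(LinearMap.mem_ker (f := P.mkQ)).1 (by rwa [Submodule.ker_mkQ])]
        rfl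
      · refine hP (eq_top_iff.2 fun m _ => ?_)
        obtain ⟨m, rfl⟩ := Submodule.Quotient.mk_surjective _ m
        have hm : x • m ∈ P := by
          rw [heq]
          change Submodule.Quotient.mk (x • P.mkQ m) = 0
          exact (Submodule.Quotient.mk_eq_zero _).2
            (Submodule.smul_mem_pointwise_smul _ _ _ trivial)
        have h0 : (Submodule.Quotient.mk m : M ⧸ P) = 0 := by
          refine hreg ?_
          change x • (Submodule.Quotient.mk m : M ⧸ P) = x • 0
          rw [smul_zero, ← Submodule.Quotient.mk_smul]
          exact (Submodule.Quotient.mk_eq_zero _).2 hm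
        rw [h0]
        exact zero_mem _
    obtain ⟨d, hd⟩ := ih (LinearMap.ker g) hlt hne
    exact ⟨d + 1, x, hx, hreg, hd.of_equiv e⟩
  · rw [not_subsingleton_iff_nontrivial] at hs
    obtain ⟨f, hf⟩ := exists_ne (0 : (R ⧸ J) →ₗ[R] (M ⧸ P))
    refine ⟨0, f 1, fun h0 => hf ?_, fun a ha => ?_⟩
    · ext
      simpa using h0
    · rw [← map_smul]
      have : a • (1 : R ⧸ J) = 0 := by
        change Submodule.Quotient.mk (a • (1 : R)) = 0
        exact (Submodule.Quotient.mk_eq_zero _).2 (by simpa using ha)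
      rw [this, map_zero]

lemma exists_regDepth [IsNoetherianRing R] {M : Type} [AddCommGroup M]
    [Module R M] [Module.Finite R M] (hM : J • (⊤ : Submodule R M) ≠ ⊤) :
    ∃ d, RegDepth J d M := by
  let e := Submodule.quotEquivOfEqBot (⊥ : Submodule R M) rfl
  obtain ⟨d, hd⟩ := exists_regDepth_quotient (⊥ : Submodule R M) (J := J) fun htop => hM (by
    have := congrArg (Submodule.map e.toLinearMap) htop
    simpa [Submodule.map_smul''] using this)
  exact ⟨d, hd.of_equiv e⟩

end RegularSequenceDepth

section ExternalTensorProduct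

open TensorProduct Pointwise

variable {k A B R : Type} [Field k] [CommRing A] [CommRing B] [CommRing R] [Algebra k A]
  [Algebra k B]

/-- `f` identifies the `R`-module `L` with the external tensor product of the `A`-module `M` and
the `B`-module `N`. -/
structure IsExtTensor (ιA : A →+* R) (ιB : B →+* R) {M N L : Type} [AddCommGroup M] [Module k M]
    [Module A M] [IsScalarTower k A M] [AddCommGroup N] [Module k N] [Module B N]
    [IsScalarTower k B N] [AddCommGroup L] [Module R L] (f : L →+ M ⊗[k] N) : Prop where
  bijective : Function.Bijective f
  map_left : ∀ a l, f (ιA a • l) = (Algebra.lsmul k k M a).rTensor N (f l)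
  map_right : ∀ b l, f (ιB b • l) = (Algebra.lsmul k k N b).lTensor M (f l)

namespace IsExtTensor

variable {ιA : A →+* R} {ιB : B →+* R} {M N L : Type} [AddCommGroup M] [Module k M]
  [Module A M] [IsScalarTower k A M] [AddCommGroup N] [Module k N] [Module B N]
  [IsScalarTower k B N] [AddCommGroup L] [Module R L] {f : L →+ M ⊗[k] N}

lemma swap (hf : IsExtTensor ιA ιB f) :
    IsExtTensor ιB ιA ((TensorProduct.comm k M N).toLinearMap.toAddMonoidHom.comp f) where
  bijective := (TensorProduct.comm k M N).bijective.comp hf.bijective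
  map_left b l := by
    change TensorProduct.comm k M N (f _) = LinearMap.rTensor M _ (TensorProduct.comm k M N (f l))
    rw [hf.map_right]
    exact LinearMap.congr_fun (TensorProduct.ext' (g :=
      ((TensorProduct.comm k M N).toLinearMap.comp (LinearMap.lTensor M (Algebra.lsmul k k N b))))
      (h := (LinearMap.rTensor M (Algebra.lsmul k k N b)).comp
        (TensorProduct.comm k M N).toLinearMap) fun _ _ => rfl) (f l)
  map_right a l := by
    change TensorProduct.comm k M N (f _) = LinearMap.lTensor N _ (TensorProduct.comm k M N (f l))
    rw [hf.map_left]
    exact LinearMap.congr_fun (TensorProduct.ext' (g :=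
      ((TensorProduct.comm k M N).toLinearMap.comp (LinearMap.rTensor N (Algebra.lsmul k k M a))))
      (h := (LinearMap.lTensor N (Algebra.lsmul k k M a)).comp
        (TensorProduct.comm k M N).toLinearMap) fun _ _ => rfl) (f l)

lemma isSMulRegular (hf : IsExtTensor ιA ιB f) {x : A} (hx : IsSMulRegular M x) :
    IsSMulRegular L (ιA x) := by
  intro l l' h
  have hinj := Module.Flat.rTensor_preserves_injective_linearMap (M := N)
    (Algebra.lsmul k k M x) hx
  refine hf.bijective.1 (hinj ?_)
  rw [← hf.map_left, ← hf.map_left]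
  exact congrArg f h

lemma exists_quotient (hf : IsExtTensor ιA ιB f) (x : A) :
    ∃ f' : QuotSMulTop (ιA x) L →+ QuotSMulTop x M ⊗[k] N, IsExtTensor ιA ιB f' := by
  let q : M →ₗ[k] QuotSMulTop x M := (Submodule.mkQ (x • (⊤ : Submodule A M))).restrictScalars k
  have hq : Function.Surjective q := fun y => by
    obtain ⟨m, rfl⟩ := Submodule.Quotient.mk_surjective (x • (⊤ : Submodule A M)) y
    exact ⟨m, rfl⟩
  have hexact : Function.Exact (Algebra.lsmul k k M x : M →ₗ[k] M) q := by
    intro m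
    refine Iff.trans (b := m ∈ x • (⊤ : Submodule A M)) (Submodule.Quotient.mk_eq_zero _) ?_
    rw [Submodule.mem_smul_pointwise_iff_exists]
    exact ⟨fun ⟨y, _, hy⟩ => ⟨y, hy⟩, fun ⟨y, hy⟩ => ⟨y, trivial, hy⟩⟩
  have hT := rTensor_exact N hexact hq
  let F : L →+ QuotSMulTop x M ⊗[k] N := (q.rTensor N).toAddMonoidHom.comp f
  have hF : ∀ l, F l = q.rTensor N (f l) := fun _ => rfl
  have hker : ∀ l, F l = 0 ↔ l ∈ (ιA x • (⊤ : Submodule R L)) := by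
    intro l
    rw [hF, hT, Submodule.mem_smul_pointwise_iff_exists]
    constructor
    · rintro ⟨u, hu⟩
      obtain ⟨l', rfl⟩ := hf.bijective.2 u
      exact ⟨l', trivial, hf.bijective.1 (by rw [hf.map_left, hu])⟩
    · rintro ⟨l', -, rfl⟩
      exact ⟨f l', (hf.map_left _ _).symm⟩
  let f' : QuotSMulTop (ιA x) L →+ QuotSMulTop x M ⊗[k] N :=
    QuotientAddGroup.lift (ιA x • (⊤ : Submodule R L)).toAddSubgroup F
      fun l hl => (hker l).2 hl
  have hf' : ∀ l : L, f' (Submodule.Quotient.mk l) = F l := fun _ => rfl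
  refine ⟨f', ⟨⟨?_, ?_⟩, ?_, ?_⟩⟩
  · rw [injective_iff_map_eq_zero]
    intro l hl
    obtain ⟨l, rfl⟩ := Submodule.Quotient.mk_surjective _ l
    exact (Submodule.Quotient.mk_eq_zero _).2 ((hker l).1 hl)
  · intro u
    obtain ⟨v, rfl⟩ := LinearMap.rTensor_surjective N hq u
    obtain ⟨l, rfl⟩ := hf.bijective.2 v
    exact ⟨Submodule.Quotient.mk l, rfl⟩
  · intro a l
    obtain ⟨l, rfl⟩ := Submodule.Quotient.mk_surjective _ l
    rw [← Submodule.Quotient.mk_smul, hf', hf', hF, hF, hf.map_left, ← LinearMap.comp_apply,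
      ← LinearMap.comp_apply, ← LinearMap.rTensor_comp, ← LinearMap.rTensor_comp]
    rfl
  · intro b l
    obtain ⟨l, rfl⟩ := Submodule.Quotient.mk_surjective _ l
    rw [← Submodule.Quotient.mk_smul, hf', hf', hF, hF, hf.map_right, ← LinearMap.comp_apply,
      ← LinearMap.comp_apply, LinearMap.rTensor_comp_lTensor, LinearMap.lTensor_comp_rTensor]

variable {JA : Ideal A} {JB : Ideal B} {JR : Ideal R}

lemma regDepth_zero (hf : IsExtTensor ιA ιB f) (hJ : JR ≤ JA.map ιA ⊔ JB.map ιB)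
    (hM : RegDepth JA 0 M) (hN : RegDepth JB 0 N) : RegDepth JR 0 L := by
  obtain ⟨u, hu, hJu⟩ := hM
  obtain ⟨v, hv, hJv⟩ := hN
  obtain ⟨w, hw⟩ := hf.bijective.2 (u ⊗ₜ v)
  refine ⟨w, ?_, fun a ha => ?_⟩
  · rintro rfl
    rw [map_zero] at hw
    have h1 : Function.Injective (LinearMap.rTensor N (LinearMap.toSpanSingleton k M u)) :=
      Module.Flat.rTensor_preserves_injective_linearMap _
        (LinearMap.ker_eq_bot.1 (LinearMap.ker_toSpanSingleton k hu))
    have h2 : LinearMap.rTensor N (LinearMap.toSpanSingleton k M u) ((1 : k) ⊗ₜ v) = 0 := by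
      rw [LinearMap.rTensor_tmul, LinearMap.toSpanSingleton_apply, one_smul, hw]
    have h3 := (map_eq_zero_iff _ h1).1 h2
    exact hv (by simpa using congrArg (TensorProduct.lid k N) h3)
  · have hle : JA.map ιA ⊔ JB.map ιB ≤ (R ∙ w).annihilator := by
      refine sup_le ?_ ?_ <;> rw [Ideal.map_le_iff_le_comap] <;> intro a ha <;>
        rw [Ideal.mem_comap, Submodule.mem_annihilator_span_singleton] <;>
        refine hf.bijective.1 ?_
      · rw [hf.map_left, hw, LinearMap.rTensor_tmul, map_zero,
          show Algebra.lsmul k k M a u = 0 from hJu a ha,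
          TensorProduct.zero_tmul]
      · rw [hf.map_right, hw, LinearMap.lTensor_tmul, map_zero,
          show Algebra.lsmul k k N a v = 0 from hJv a ha,
          TensorProduct.tmul_zero]
    exact (Submodule.mem_annihilator_span_singleton _ _).1 (hle (hJ ha))

lemma regDepth_left (hf : IsExtTensor ιA ιB f) (hJ : JR ≤ JA.map ιA ⊔ JB.map ιB)
    (hA : JA.map ιA ≤ JR) {d : ℕ}
    (hM : RegDepth JA d M) (hN : RegDepth JB 0 N) : RegDepth JR d L := by
  induction d generalizing M L with
  | zero => exact hf.regDepth_zero hJ hM hN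
  | succ d ih =>
    obtain ⟨x, hx, hreg, hq⟩ := hM
    obtain ⟨f', hf'⟩ := hf.exists_quotient x
    exact ⟨ιA x, hA (Ideal.mem_map_of_mem _ hx), hf.isSMulRegular hreg, ih hf' hq⟩

lemma regDepth (hf : IsExtTensor ιA ιB f) (hJ : JR ≤ JA.map ιA ⊔ JB.map ιB)
    (hA : JA.map ιA ≤ JR) (hB : JB.map ιB ≤ JR) {d e : ℕ}
    (hM : RegDepth JA d M) (hN : RegDepth JB e N) : RegDepth JR (d + e) L := by
  induction e generalizing N L with
  | zero => exact hf.regDepth_left hJ hA hM hN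
  | succ e ih =>
    obtain ⟨x, hx, hreg, hq⟩ := hN
    obtain ⟨f', hf'⟩ := hf.swap.exists_quotient x
    exact ⟨ιB x, hB (Ideal.mem_map_of_mem _ hx), hf.swap.isSMulRegular hreg, ih hf'.swap hq⟩

end IsExtTensor

end ExternalTensorProduct

noncomputable section ConvexModules

variable {σ : Type}

/-- The `k`-vector space with basis the exponent vectors in `S`. -/
def ConvexModule (k : Type) [Field k] (_ : ℕ) (S : Set (σ →₀ ℕ)) : Type := S →₀ k

namespace ConvexModule

variable {k : Type} [Field k] {n : ℕ} {S T : Set (σ →₀ ℕ)}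

instance : AddCommGroup (ConvexModule k n S) := inferInstanceAs (AddCommGroup (S →₀ k))

instance : Module k (ConvexModule k n S) := inferInstanceAs (Module k (S →₀ k))

open Classical in
/-- The element of `ConvexModule k n S` with a single coefficient `c` at `s`; it is zero if
`s ∉ S`. -/
def term (k : Type) [Field k] (n : ℕ) (S : Set (σ →₀ ℕ)) (s : σ →₀ ℕ) :
    k →ₗ[k] ConvexModule k n S :=
  if h : s ∈ S then Finsupp.lsingle (⟨s, h⟩ : S) else 0

lemma term_of_notMem {s : σ →₀ ℕ} (h : s ∉ S) : term k n S s = 0 := dif_neg h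

lemma term_of_mem {s : σ →₀ ℕ} (h : s ∈ S) (c : k) :
    term k n S s c = Finsupp.single (⟨s, h⟩ : S) c :=
  LinearMap.congr_fun (dif_pos h : term k n S s = Finsupp.lsingle (⟨s, h⟩ : S)) c

/-- The coefficient of an element of `ConvexModule k n S` at a given exponent. -/
def coeff (s : S) : ConvexModule k n S →ₗ[k] k := Finsupp.lapply s

lemma ext_coeff {x y : ConvexModule k n S} (h : ∀ s, coeff s x = coeff s y) : x = y := Finsupp.ext h

open Classical in
lemma coeff_term (s : S) (t : σ →₀ ℕ) (c : k) :
    coeff s (term k n S t c) = if t = s then c else 0 := by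
  by_cases h : t ∈ S
  · rw [term_of_mem h]
    change Finsupp.single (⟨t, h⟩ : S) c s = _
    rw [Finsupp.single_apply]
    exact if_congr Subtype.ext_iff rfl rfl
  · rw [term_of_notMem h, if_neg (by rintro rfl; exact h s.2)]
    rfl

lemma induction {p : ConvexModule k n S → Prop} (x : ConvexModule k n S) (zero : p 0)
    (add : ∀ x y, p x → p y → p (x + y)) (term : ∀ s ∈ S, ∀ c, p (term k n S s c)) : p x :=
  Finsupp.induction_linear x zero add fun s c => by
    have := term s s.2 c
    rwa [term_of_mem s.2] at this

/-- The `k`-linear map with prescribed values on the basis. -/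
def lift {V : Type} [AddCommGroup V] [Module k V] (f : (σ →₀ ℕ) → V) : ConvexModule k n S →ₗ[k] V :=
  Finsupp.linearCombination k fun s : S => f s

lemma lift_term {V : Type} [AddCommGroup V] [Module k V] (f : (σ →₀ ℕ) → V) {s : σ →₀ ℕ}
    (hs : s ∈ S) (c : k) : lift f (term k n S s c) = c • f s := by
  rw [term_of_mem hs]
  exact Finsupp.linearCombination_single _ _ _

/-- Multiplication by a monomial. -/
def shift (g : σ →₀ ℕ) : Module.End k (ConvexModule k n S) := lift fun s => term k n S (s + n • g) 1

lemma shift_term (g : σ →₀ ℕ) {s : σ →₀ ℕ} (hs : s ∈ S) (c : k) :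
    shift g (term k n S s c) = term k n S (s + n • g) c := by
  rw [shift, lift_term _ hs, ← map_smul, smul_eq_mul, mul_one]

/-- Multiplication by monomials, as a monoid homomorphism. -/
def shiftHom (k : Type) [Field k] (n : ℕ) (S : Set (σ →₀ ℕ)) [hS : S.OrdConnected] :
    Multiplicative (σ →₀ ℕ) →* Module.End k (ConvexModule k n S) where
  toFun g := shift g.toAdd
  map_one' := by
    ext x
    induction x using induction with
    | zero => simp
    | add x y hx hy => rw [map_add, map_add, hx, hy]
    | term s hs c => simp [shift_term, hs]
  map_mul' g h := by
    ext x
    induction x using induction with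
    | zero => simp
    | add x y hx hy => rw [map_add, map_add, hx, hy]
    | term s hs c =>
      rw [Module.End.mul_apply, shift_term _ hs, shift_term _ hs]
      by_cases hm : s + n • h.toAdd ∈ S
      · rw [shift_term _ hm, toAdd_mul, smul_add, add_comm (n • g.toAdd), add_assoc]
      · rw [term_of_notMem hm, term_of_notMem, LinearMap.zero_apply, map_zero]
        intro hmem
        refine hm (hS.out hs hmem ⟨le_self_add, ?_⟩)
        rw [toAdd_mul, smul_add, add_comm (n • g.toAdd), ← add_assoc]
        exact le_self_add

/-- The action of the polynomial ring on `ConvexModule k n S`. -/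
def actionHom (k : Type) [Field k] (n : ℕ) (S : Set (σ →₀ ℕ)) [S.OrdConnected] :
    MvPolynomial σ k →ₐ[k] Module.End k (ConvexModule k n S) :=
  AddMonoidAlgebra.lift k (Module.End k (ConvexModule k n S)) (σ →₀ ℕ) (shiftHom k n S)

instance [S.OrdConnected] : Module (MvPolynomial σ k) (ConvexModule k n S) :=
  Module.compHom _ (actionHom k n S).toRingHom

lemma monomial_smul_term [S.OrdConnected] (g : σ →₀ ℕ) (a : k) {s : σ →₀ ℕ} (hs : s ∈ S) (c : k) :
    monomial g a • term k n S s c = term k n S (s + n • g) (a * c) := by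
  change actionHom k n S (AddMonoidAlgebra.single g a) _ = _
  rw [actionHom, AddMonoidAlgebra.lift_single, LinearMap.smul_apply]
  change a • shift g _ = _
  rw [shift_term _ hs, ← map_smul, smul_eq_mul]

instance [S.OrdConnected] : IsScalarTower k (MvPolynomial σ k) (ConvexModule k n S) where
  smul_assoc a p x := by
    change actionHom k n S (a • p) x = a • actionHom k n S p x
    rw [map_smul, LinearMap.smul_apply]

/-- An additive map that is semilinear on monomials is semilinear. -/
lemma map_smul_of_monomial [S.OrdConnected] {R' V : Type} [CommRing R'] [AddCommGroup V]
    [Module R' V] (φ : MvPolynomial σ k →+* R') (F : ConvexModule k n S →+ V)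
    (h : ∀ g a, ∀ s ∈ S, ∀ c, F (term k n S (s + n • g) (a * c)) =
      φ (monomial g a) • F (term k n S s c)) (p : MvPolynomial σ k) (x : ConvexModule k n S) :
    F (p • x) = φ p • F x := by
  induction x using induction with
  | zero => simp
  | add x y hx hy => rw [smul_add, map_add, map_add, hx, hy, smul_add]
  | term s hs c =>
    induction p using MvPolynomial.induction_on' with
    | monomial g a => rw [monomial_smul_term _ _ hs, h _ _ _ hs]
    | add p q hp hq => rw [add_smul, map_add, map_add, hp, hq, add_smul]

/-- The identity, as a map from `ConvexModule k n S` to `ConvexModule k 1 S`. -/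
def toOne (k : Type) [Field k] (n : ℕ) (S : Set (σ →₀ ℕ)) :
    ConvexModule k n S →+ ConvexModule k 1 S :=
  AddMonoidHom.id (S →₀ k)

lemma toOne_term (s : σ →₀ ℕ) (c : k) : toOne k n S (term k n S s c) = term k 1 S s c := rfl

/-- The map keeping the coefficients at the exponents in `T`. -/
def resₗ (k : Type) [Field k] (n : ℕ) (S T : Set (σ →₀ ℕ)) :
    ConvexModule k n S →ₗ[k] ConvexModule k n T :=
  lift fun s => term k n T s 1

lemma resₗ_term {s : σ →₀ ℕ} (hs : s ∈ S) (c : k) :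
    resₗ k n S T (term k n S s c) = term k n T s c := by
  rw [resₗ, lift_term _ hs, ← map_smul, smul_eq_mul, mul_one]

open Classical in
lemma coeff_resₗ (x : ConvexModule k n S) (t : T) :
    coeff t (resₗ k n S T x) = if h : (t : σ →₀ ℕ) ∈ S then coeff ⟨t, h⟩ x else 0 := by
  induction x using induction with
  | zero => simp
  | add x y hx hy => rw [map_add, map_add, hx, hy]; split_ifs <;> simp
  | term s hs c =>
    rw [resₗ_term hs, coeff_term]
    split_ifs with h1 h2 h2
    · rw [coeff_term, if_pos h1]
    · exact absurd (h1 ▸ hs) h2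
    · rw [coeff_term, if_neg h1]
    · rfl

/-- The map keeping the coefficients at the exponents in `T`, when it is linear over the
polynomial ring. -/
def res (k : Type) [Field k] (n : ℕ) {S T : Set (σ →₀ ℕ)} [S.OrdConnected] [T.OrdConnected]
    (h : ∀ s ∈ S, ∀ t ∈ T, s ≤ t → (s ∈ T ↔ t ∈ S)) :
    ConvexModule k n S →ₗ[MvPolynomial σ k] ConvexModule k n T where
  toFun := resₗ k n S T
  map_add' := map_add _
  map_smul' := map_smul_of_monomial (RingHom.id _) (resₗ k n S T).toAddMonoidHom (by
    intro g a s hs c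
    change resₗ k n S T _ = monomial g a • resₗ k n S T _
    rw [resₗ_term hs]
    by_cases ht : s + n • g ∈ T
    · by_cases ht' : s + n • g ∈ S
      · rw [resₗ_term ht', monomial_smul_term _ _ ((h _ hs _ ht le_self_add).2 ht')]
      · rw [term_of_notMem ht', term_of_notMem fun hs' => ht' ((h _ hs _ ht le_self_add).1 hs')]
        simp
    · by_cases hs' : s ∈ T
      · rw [monomial_smul_term _ _ hs', term_of_notMem ht]
        by_cases ht' : s + n • g ∈ S
        · rw [resₗ_term ht', term_of_notMem ht]
        · simp [term_of_notMem ht']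
      · rw [term_of_notMem hs']
        by_cases ht' : s + n • g ∈ S
        · simp [resₗ_term ht', term_of_notMem ht]
        · simp [term_of_notMem ht'])

section Exact

variable [S.OrdConnected] [T.OrdConnected]

lemma res_apply (h : ∀ s ∈ S, ∀ t ∈ T, s ≤ t → (s ∈ T ↔ t ∈ S)) (x : ConvexModule k n S) :
    res k n h x = resₗ k n S T x := rfl

lemma res_injective (h : ∀ s ∈ S, ∀ t ∈ T, s ≤ t → (s ∈ T ↔ t ∈ S)) (hST : S ⊆ T) :
    Function.Injective (res k n h) := fun x y hxy => ext_coeff fun s => by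
  have := congrArg (coeff ⟨s, hST s.2⟩) hxy
  simpa [res_apply, coeff_resₗ] using this

lemma res_surjective (h : ∀ s ∈ S, ∀ t ∈ T, s ≤ t → (s ∈ T ↔ t ∈ S)) (hTS : T ⊆ S) :
    Function.Surjective (res k n h) := fun y => by
  refine ⟨resₗ k n T S y, ext_coeff fun t => ?_⟩
  simp [res_apply, coeff_resₗ, hTS t.2]

lemma res_exact {U : Set (σ →₀ ℕ)} [U.OrdConnected]
    (h : ∀ s ∈ S, ∀ t ∈ T, s ≤ t → (s ∈ T ↔ t ∈ S))
    (h' : ∀ s ∈ T, ∀ t ∈ U, s ≤ t → (s ∈ U ↔ t ∈ T))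
    (hTU : ∀ t ∈ T, t ∈ S ↔ t ∉ U) (hU : U ⊆ T) :
    Function.Exact (res k n h) (res k n h') := fun x => by
  classical
  constructor
  · intro hx
    refine ⟨resₗ k n T S x, ext_coeff fun t => ?_⟩
    rw [res_apply, coeff_resₗ]
    split_ifs with hs
    · simp [coeff_resₗ]
    · have ht : (t : σ →₀ ℕ) ∈ U := by
        by_contra hc
        exact hs ((hTU _ t.2).2 hc)
      have := congrArg (coeff ⟨t, ht⟩) hx
      rw [res_apply, coeff_resₗ, dif_pos t.2, map_zero] at this
      exact this.symm
  · rintro ⟨y, rfl⟩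
    refine ext_coeff fun u => ?_
    rw [res_apply, coeff_resₗ, dif_pos (hU u.2), res_apply, coeff_resₗ, map_zero,
      dif_neg fun hs => (hTU _ (hU u.2)).1 hs u.2]

end Exact

lemma subsingleton_of_eq_empty (hS : S = ∅) : Subsingleton (ConvexModule k n S) := by
  subst hS
  exact ⟨fun x y => ext_coeff fun s => s.2.elim⟩

end ConvexModule

end ConvexModules

noncomputable section ConvexModuleDepth

open PaperHTT TensorProduct

variable {σ : Type} {k : Type} [Field k]

namespace ConvexModule

variable {n : ℕ} {S T : Set (σ →₀ ℕ)} [S.OrdConnected]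

lemma finite_of_isLowerSet [Finite σ] (hn : 0 < n) (hS : IsLowerSet S) :
    Module.Finite (MvPolynomial σ k) (ConvexModule k n S) := by
  have hfin : ((fun t => term k n S t 1) '' {t | ∀ i, t i ≤ n}).Finite :=
    ((Set.Finite.pi' fun _ : σ => Set.finite_Iic n).preimage
      DFunLike.coe_injective.injOn).image _
  refine ⟨⟨hfin.toFinset, ?_⟩⟩
  rw [Set.Finite.coe_toFinset, eq_top_iff]
  rintro x -
  induction x using induction with
  | zero => exact zero_mem _
  | add x y hx hy => exact add_mem hx hy
  | term s hs c =>
    let r : σ →₀ ℕ := s.mapRange (· % n) (Nat.zero_mod n)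
    let q : σ →₀ ℕ := s.mapRange (· / n) (Nat.zero_div n)
    have hrq : r + n • q = s := by
      ext i
      exact Nat.mod_add_div (s i) n
    have hr : r ∈ S := hS (hrq ▸ le_self_add) hs
    have : term k n S s c = monomial q c • term k n S r 1 := by
      rw [monomial_smul_term _ _ hr, hrq, mul_one]
    rw [this]
    refine Submodule.smul_mem _ _ (Submodule.subset_span ⟨r, fun i => ?_, rfl⟩)
    exact (Nat.mod_lt _ hn).le

lemma finite [Finite σ] (hn : 0 < n) :
    Module.Finite (MvPolynomial σ k) (ConvexModule k n S) := by
  let D : Set (σ →₀ ℕ) := lowerClosure S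
  have hD : IsLowerSet D := (lowerClosure S).lower
  have : D.OrdConnected := hD.ordConnected
  have hfin := finite_of_isLowerSet (k := k) hn hD
  have := isNoetherian_of_isNoetherianRing_of_finite (MvPolynomial σ k) (ConvexModule k n D)
  refine Module.Finite.of_injective (res k n (S := S) (T := D) ?_)
    (res_injective _ subset_lowerClosure)
  intro s hs t ht hst
  obtain ⟨u, hu, htu⟩ := ht
  exact ⟨fun _ => Set.OrdConnected.out ‹_› hs hu ⟨hst, htu⟩, fun _ => subset_lowerClosure hs⟩

lemma smul_top_ne_top [Finite σ] (hn : 0 < n) (hS : S.Nonempty) :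
    maxHomIdeal k σ • (⊤ : Submodule (MvPolynomial σ k) (ConvexModule k n S)) ≠ ⊤ := by
  classical
  obtain ⟨s, hs, hmin⟩ := WellFounded.has_min (wellFounded_lt (α := σ →₀ ℕ)) S hS
  have key : ∀ r ∈ maxHomIdeal k σ, ∀ x : ConvexModule k n S, coeff ⟨s, hs⟩ (r • x) = 0 := by
    intro r hr
    refine Submodule.span_induction ?_ ?_ ?_ ?_ hr
    · rintro _ ⟨i, rfl⟩ x
      induction x using induction with
      | zero => simp
      | add x y hx hy => rw [smul_add, map_add, hx, hy, add_zero]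
      | term t ht c =>
        rw [X, monomial_smul_term _ _ ht, coeff_term, if_neg]
        intro h
        refine hmin t ht (lt_of_le_of_ne (le_self_add.trans_eq h) ?_)
        rintro rfl
        have := DFunLike.congr_fun h i
        simp at this
        omega
    · intro x
      rw [zero_smul, map_zero]
    · intro p q _ _ hp hq x
      rw [add_smul, map_add, hp, hq, add_zero]
    · intro a p _ hp x
      rw [smul_eq_mul, mul_comm, mul_smul, hp]
  intro htop
  have h1 : ∀ x ∈ maxHomIdeal k σ • (⊤ : Submodule (MvPolynomial σ k) (ConvexModule k n S)),
      coeff ⟨s, hs⟩ x = 0 := fun x hx =>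
    Submodule.smul_induction_on hx (fun r hr y _ => key r hr y)
      fun x y hx hy => by rw [map_add, hx, hy, add_zero]
  have h2 := h1 (term k n S s 1) (by rw [htop]; trivial)
  rw [coeff_term, if_pos rfl] at h2
  exact one_ne_zero h2

lemma exists_regDepth [Finite σ] (k : Type) [Field k] (hn : 0 < n) (hS : S.Nonempty) :
    ∃ d, RegDepth (maxHomIdeal k σ) d (ConvexModule k n S) := by
  have := finite (k := k) (S := S) hn
  exact _root_.exists_regDepth (smul_top_ne_top hn hS)

/-- `ConvexModule k n S` is the pullback of `ConvexModule k 1 S` along `xᵢ ↦ xᵢ ^ n`. -/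
lemma regDepth_one [Finite σ] (hn : 0 < n) {d : ℕ}
    (h : RegDepth (maxHomIdeal k σ) d (ConvexModule k n S)) :
    RegDepth (maxHomIdeal k σ) d (ConvexModule k 1 S) := by
  let φ : MvPolynomial σ k →+* MvPolynomial σ k := (expand n : _ →ₐ[k] MvPolynomial σ k).toRingHom
  have hX : ∀ i, φ (X i) = X i ^ n := fun i => expand_X n i
  let e : ConvexModule k n S →ₛₗ[φ] ConvexModule k 1 S :=
    { toFun := toOne k n S
      map_add' := map_add _
      map_smul' := map_smul_of_monomial φ (toOne k n S) (by
        intro g a s hs c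
        change _ = expand n (monomial g a) • _
        rw [expand_monomial, toOne_term, toOne_term, monomial_smul_term _ _ hs, one_smul]) }
  have h1 : (maxHomIdeal k σ).map φ ≤ maxHomIdeal k σ := by
    rw [maxHomIdeal, Ideal.map_span, Ideal.span_le]
    rintro _ ⟨_, ⟨i, rfl⟩, rfl⟩
    rw [hX]
    have hi : (X i : MvPolynomial σ k) ∈ Ideal.span (Set.range X) := Ideal.subset_span ⟨i, rfl⟩
    exact Ideal.pow_mem_of_mem _ hi n hn
  have h2 : maxHomIdeal k σ ≤ ((maxHomIdeal k σ).map φ).radical := by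
    rw [maxHomIdeal, Ideal.span_le]
    rintro _ ⟨i, rfl⟩
    refine Ideal.mem_radical_iff.2 ⟨n, ?_⟩
    rw [← hX]
    have hi : (X i : MvPolynomial σ k) ∈ Ideal.span (Set.range X) := Ideal.subset_span ⟨i, rfl⟩
    exact Ideal.mem_map_of_mem φ hi
  obtain ⟨t, ht⟩ := Ideal.exists_pow_le_of_le_radical_of_fg h2 (IsNoetherian.noetherian _)
  exact h.of_semilinear h1 ht e Function.bijective_id

/-- Dividing exponents by `n`, discarding the exponents that are not multiples of `n`. -/
lemma extVanishing_of_dilation [T.OrdConnected] (hn : 0 < n) (hST : ∀ s, n • s ∈ S ↔ s ∈ T) {d : ℕ}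
    (h : ExtVanishing (maxHomIdeal k σ) (ConvexModule k n S) d) :
    ExtVanishing (maxHomIdeal k σ) (ConvexModule k 1 T) d := by
  classical
  have hdiv : ∀ t : σ →₀ ℕ, ((n • t).mapRange (· / n) (Nat.zero_div n) : σ →₀ ℕ) = t := by
    intro t
    ext i
    exact Nat.mul_div_cancel_left _ hn
  have hinj : ∀ s t : σ →₀ ℕ, n • s = n • t → s = t := fun s t hst => by
    rw [← hdiv s, hst, hdiv]
  let i₀ : ConvexModule k 1 T →ₗ[k] ConvexModule k n S := lift fun s => term k n S (n • s) 1
  have hi₀ : ∀ s ∈ T, ∀ c, i₀ (term k 1 T s c) = term k n S (n • s) c := fun s hs c => by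
    rw [lift_term _ hs, ← map_smul, smul_eq_mul, mul_one]
  let p₀ : ConvexModule k n S →ₗ[k] ConvexModule k 1 T := lift fun t =>
    if ∃ s, n • s = t then term k 1 T (t.mapRange (· / n) (Nat.zero_div n)) 1 else 0
  have hp₀ : ∀ s ∈ T, ∀ c, p₀ (term k n S (n • s) c) = term k 1 T s c := fun s hs c => by
    rw [lift_term _ ((hST s).2 hs), if_pos ⟨s, rfl⟩, hdiv, ← map_smul, smul_eq_mul, mul_one]
  have hp₀' : ∀ t c, (∀ s, n • s ≠ t) → p₀ (term k n S t c) = 0 := fun t c ht => by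
    by_cases hts : t ∈ S
    · rw [lift_term _ hts, if_neg fun ⟨s, hs⟩ => ht s hs, smul_zero]
    · rw [term_of_notMem hts, LinearMap.zero_apply, map_zero]
  let i : ConvexModule k 1 T →ₗ[MvPolynomial σ k] ConvexModule k n S :=
    { toFun := i₀
      map_add' := map_add _
      map_smul' := map_smul_of_monomial (RingHom.id _) i₀.toAddMonoidHom (by
        intro g a s hs c
        change i₀ _ = monomial g a • i₀ _
        rw [hi₀ s hs, monomial_smul_term _ _ ((hST s).2 hs), one_smul, ← smul_add]
        by_cases hg : s + g ∈ T
        · rw [hi₀ _ hg]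
        · rw [term_of_notMem hg, term_of_notMem fun hc => hg ((hST _).1 hc),
            LinearMap.zero_apply, map_zero, LinearMap.zero_apply]) }
  let p : ConvexModule k n S →ₗ[MvPolynomial σ k] ConvexModule k 1 T :=
    { toFun := p₀
      map_add' := map_add _
      map_smul' := map_smul_of_monomial (RingHom.id _) p₀.toAddMonoidHom (by
        intro g a t ht c
        change p₀ _ = monomial g a • p₀ _
        by_cases hs : ∃ s, n • s = t
        · obtain ⟨s, rfl⟩ := hs
          have hs := (hST s).1 ht
          rw [hp₀ s hs, monomial_smul_term _ _ hs, one_smul, ← smul_add]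
          by_cases hg : s + g ∈ T
          · rw [hp₀ _ hg]
          · rw [term_of_notMem hg, term_of_notMem fun hc => hg ((hST _).1 hc),
              LinearMap.zero_apply, map_zero, LinearMap.zero_apply]
        · push Not at hs
          rw [hp₀' t c hs, smul_zero, hp₀']
          intro s hsg
          refine hs (s - g) ?_
          ext j
          have := DFunLike.congr_fun hsg j
          simp only [Finsupp.smul_apply, Finsupp.add_apply, smul_eq_mul,
            Finsupp.tsub_apply] at this ⊢
          rw [Nat.mul_sub, this, Nat.add_sub_cancel]) }
  refine h.of_retract i p fun x => ?_
  change p₀ (i₀ x) = x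
  induction x using induction with
  | zero => simp
  | add x y hx hy => rw [map_add, map_add, hx, hy]
  | term s hs c => rw [hi₀ s hs, hp₀ s hs]

end ConvexModule

section Product

variable {τ : Type} (S : Set (σ →₀ ℕ)) (T : Set (τ →₀ ℕ))

/-- The product of two sets of exponents, as a set of exponents in the disjoint union of the two
sets of variables. -/
def prodExponents : Set (σ ⊕ τ →₀ ℕ) :=
  {u | (Finsupp.sumFinsuppAddEquivProdFinsupp u).1 ∈ S ∧
    (Finsupp.sumFinsuppAddEquivProdFinsupp u).2 ∈ T}

variable {S T}

lemma sumFinsuppAddEquivProdFinsupp_mono {u v : σ ⊕ τ →₀ ℕ} (h : u ≤ v) :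
    Finsupp.sumFinsuppAddEquivProdFinsupp u ≤ Finsupp.sumFinsuppAddEquivProdFinsupp v :=
  ⟨fun i => h (Sum.inl i), fun i => h (Sum.inr i)⟩

instance [hS : S.OrdConnected] [hT : T.OrdConnected] : (prodExponents S T).OrdConnected :=
  ⟨fun _ hu _ hv _ hw =>
    ⟨hS.out hu.1 hv.1 ⟨(sumFinsuppAddEquivProdFinsupp_mono hw.1).1,
      (sumFinsuppAddEquivProdFinsupp_mono hw.2).1⟩,
    hT.out hu.2 hv.2 ⟨(sumFinsuppAddEquivProdFinsupp_mono hw.1).2,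
      (sumFinsuppAddEquivProdFinsupp_mono hw.2).2⟩⟩⟩

/-- Exponents in the product set are pairs of exponents. -/
def prodExponentsEquiv (S : Set (σ →₀ ℕ)) (T : Set (τ →₀ ℕ)) : prodExponents S T ≃ S × T where
  toFun u := (⟨_, u.2.1⟩, ⟨_, u.2.2⟩)
  invFun p := ⟨Finsupp.sumFinsuppAddEquivProdFinsupp.symm (p.1, p.2), by
    simp [prodExponents]⟩
  left_inv u := by simp
  right_inv p := by simp

namespace ConvexModule

/-- The module of a product set is the tensor product of the modules. -/
def prodEquiv (k : Type) [Field k] (S : Set (σ →₀ ℕ)) (T : Set (τ →₀ ℕ)) :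
    ConvexModule k 1 (prodExponents S T) ≃ₗ[k] ConvexModule k 1 S ⊗[k] ConvexModule k 1 T :=
  (Finsupp.domLCongr (prodExponentsEquiv S T)).trans (finsuppTensorFinsupp' k S T).symm

lemma prodEquiv_term {u : σ ⊕ τ →₀ ℕ} (hu : u ∈ prodExponents S T) (a b : k) :
    prodEquiv k S T (term k 1 _ u (a * b)) =
      term k 1 S (Finsupp.sumFinsuppAddEquivProdFinsupp u).1 a ⊗ₜ
        term k 1 T (Finsupp.sumFinsuppAddEquivProdFinsupp u).2 b := by
  rw [term_of_mem hu, term_of_mem hu.1, term_of_mem hu.2]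
  change (finsuppTensorFinsupp' k S T).symm
    (Finsupp.domLCongr (prodExponentsEquiv S T) (Finsupp.single _ _)) = _
  rw [Finsupp.domLCongr_single]
  exact finsuppTensorFinsupp'_symm_single_mul k S T _ a b

lemma sumFinsuppAddEquivProdFinsupp_mapDomain_inl (g : σ →₀ ℕ) :
    Finsupp.sumFinsuppAddEquivProdFinsupp (g.mapDomain (Sum.inl : σ → σ ⊕ τ)) = (g, 0) := by
  ext i
  · exact Finsupp.mapDomain_apply Sum.inl_injective g i
  · exact Finsupp.mapDomain_of_notMem_range g _ (by simp)

lemma sumFinsuppAddEquivProdFinsupp_mapDomain_inr (g : τ →₀ ℕ) :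
    Finsupp.sumFinsuppAddEquivProdFinsupp (g.mapDomain (Sum.inr : τ → σ ⊕ τ)) = (0, g) := by
  ext i
  · exact Finsupp.mapDomain_of_notMem_range g _ (by simp)
  · exact Finsupp.mapDomain_apply Sum.inr_injective g i

variable [S.OrdConnected] [T.OrdConnected]

lemma isExtTensor_prodEquiv :
    IsExtTensor (rename (Sum.inl : σ → σ ⊕ τ) : _ →ₐ[k] _).toRingHom
      (rename (Sum.inr : τ → σ ⊕ τ) : _ →ₐ[k] _).toRingHom
      (prodEquiv k S T).toLinearMap.toAddMonoidHom where
  bijective := (prodEquiv k S T).bijective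
  map_left p x := by
    change prodEquiv k S T (rename Sum.inl p • x) =
      LinearMap.rTensor _ _ (prodEquiv k S T x)
    induction x using induction with
    | zero => simp
    | add x y hx hy => rw [smul_add, map_add, map_add, map_add, hx, hy]
    | term u hu c =>
      rw [← mul_one c, prodEquiv_term hu, LinearMap.rTensor_tmul]
      change _ = (p • term k 1 S _ c) ⊗ₜ[k] _
      induction p using MvPolynomial.induction_on' with
      | add p q hp hq => rw [map_add, add_smul, map_add, hp, hq, add_smul, TensorProduct.add_tmul]
      | monomial g a =>
        rw [rename_monomial, monomial_smul_term _ _ hu, monomial_smul_term _ _ hu.1, one_smul,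
          one_smul, ← mul_assoc]
        by_cases h : (Finsupp.sumFinsuppAddEquivProdFinsupp u).1 + g ∈ S
        · rw [prodEquiv_term, map_add, sumFinsuppAddEquivProdFinsupp_mapDomain_inl]
          · simp
          · rw [prodExponents, Set.mem_ofPred_eq, map_add,
              sumFinsuppAddEquivProdFinsupp_mapDomain_inl]
            simpa using ⟨h, hu.2⟩
        · rw [term_of_notMem h, term_of_notMem]
          · simp
          · rw [prodExponents, Set.mem_ofPred_eq, map_add,
              sumFinsuppAddEquivProdFinsupp_mapDomain_inl]
            exact fun hc => h hc.1
  map_right p x := by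
    change prodEquiv k S T (rename Sum.inr p • x) =
      LinearMap.lTensor _ _ (prodEquiv k S T x)
    induction x using induction with
    | zero => simp
    | add x y hx hy => rw [smul_add, map_add, map_add, map_add, hx, hy]
    | term u hu c =>
      rw [← one_mul c, prodEquiv_term hu, LinearMap.lTensor_tmul]
      change _ = _ ⊗ₜ[k] (p • term k 1 T _ c)
      induction p using MvPolynomial.induction_on' with
      | add p q hp hq => rw [map_add, add_smul, map_add, hp, hq, add_smul, TensorProduct.tmul_add]
      | monomial g a =>
        rw [rename_monomial, monomial_smul_term _ _ hu, monomial_smul_term _ _ hu.2, one_smul,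
          one_smul, mul_left_comm]
        by_cases h : (Finsupp.sumFinsuppAddEquivProdFinsupp u).2 + g ∈ T
        · rw [prodEquiv_term, map_add, sumFinsuppAddEquivProdFinsupp_mapDomain_inr]
          · simp
          · rw [prodExponents, Set.mem_ofPred_eq, map_add,
              sumFinsuppAddEquivProdFinsupp_mapDomain_inr]
            simpa using ⟨hu.1, h⟩
        · rw [term_of_notMem h, term_of_notMem]
          · simp
          · rw [prodExponents, Set.mem_ofPred_eq, map_add,
              sumFinsuppAddEquivProdFinsupp_mapDomain_inr]
            exact fun hc => h hc.2

lemma regDepth_prod {d e : ℕ} (hS : RegDepth (maxHomIdeal k σ) d (ConvexModule k 1 S))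
    (hT : RegDepth (maxHomIdeal k τ) e (ConvexModule k 1 T)) :
    RegDepth (maxHomIdeal k (σ ⊕ τ)) (d + e) (ConvexModule k 1 (prodExponents S T)) := by
  refine isExtTensor_prodEquiv.regDepth ?_ ?_ ?_ hS hT <;>
    simp only [maxHomIdeal, Ideal.map_span, Ideal.span_le]
  · rintro _ ⟨i | i, rfl⟩
    · exact Ideal.mem_sup_left (Ideal.subset_span ⟨X i, ⟨i, rfl⟩, rename_X _ _⟩)
    · exact Ideal.mem_sup_right (Ideal.subset_span ⟨X i, ⟨i, rfl⟩, rename_X _ _⟩)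
  · rintro _ ⟨_, ⟨i, rfl⟩, rfl⟩
    exact Ideal.subset_span ⟨Sum.inl i, (rename_X _ _).symm⟩
  · rintro _ ⟨_, ⟨i, rfl⟩, rfl⟩
    exact Ideal.subset_span ⟨Sum.inr i, (rename_X _ _).symm⟩

end ConvexModule

end Product

end ConvexModuleDepth

/-- Superadditive functions on exponent vectors. -/
structure SuperaddFun (σ : Type) where
  /-- The underlying function. -/
  toFun : (σ →₀ ℕ) → ℕ
  add_le' : ∀ s t, toFun s + toFun t ≤ toFun (s + t)

namespace SuperaddFun

variable {σ τ : Type}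

instance : CoeFun (SuperaddFun σ) fun _ => (σ →₀ ℕ) → ℕ := ⟨toFun⟩

variable (o : SuperaddFun σ) (p : SuperaddFun τ)

lemma add_le (s t : σ →₀ ℕ) : o s + o t ≤ o (s + t) := o.add_le' s t

lemma map_zero : o 0 = 0 := by
  have := o.add_le 0 0
  rw [add_zero] at this
  omega

lemma mono : Monotone o := fun s t h => by
  obtain ⟨u, rfl⟩ := exists_add_of_le h
  have := o.add_le s u
  omega

lemma mul_le (n : ℕ) (s : σ →₀ ℕ) : n * o s ≤ o (n • s) := by
  induction n with
  | zero => simp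
  | succ n ih =>
    rw [succ_nsmul, add_mul, one_mul]
    exact (Nat.add_le_add_right ih _).trans (o.add_le _ _)

/-- The exponents of order less than `n`. -/
def below (n : ℕ) : Set (σ →₀ ℕ) := {s | o s < n}

/-- The exponents of order exactly `n`. -/
def level (n : ℕ) : Set (σ →₀ ℕ) := {s | o s = n}

lemma mem_below {n : ℕ} {s : σ →₀ ℕ} : s ∈ o.below n ↔ o s < n := Iff.rfl

lemma mem_level {n : ℕ} {s : σ →₀ ℕ} : s ∈ o.level n ↔ o s = n := Iff.rfl

instance (n : ℕ) : (o.below n).OrdConnected := Set.ordConnected_Iio.preimage_mono o.mono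

instance (n : ℕ) : (o.level n).OrdConnected := Set.ordConnected_singleton.preimage_mono o.mono

lemma zero_mem_below {n : ℕ} (hn : 0 < n) : (0 : σ →₀ ℕ) ∈ o.below n := by
  rwa [mem_below, map_zero]

/-- The superadditive function `(s, t) ↦ o s + p t`. -/
noncomputable def prod : SuperaddFun (σ ⊕ τ) where
  toFun u := o (Finsupp.sumFinsuppAddEquivProdFinsupp u).1 +
    p (Finsupp.sumFinsuppAddEquivProdFinsupp u).2
  add_le' u v := by
    rw [map_add, Prod.fst_add, Prod.snd_add]
    have h1 := o.add_le (Finsupp.sumFinsuppAddEquivProdFinsupp u).1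
      (Finsupp.sumFinsuppAddEquivProdFinsupp v).1
    have h2 := p.add_le (Finsupp.sumFinsuppAddEquivProdFinsupp u).2
      (Finsupp.sumFinsuppAddEquivProdFinsupp v).2
    omega

lemma prod_apply (u : σ ⊕ τ →₀ ℕ) : o.prod p u =
    o (Finsupp.sumFinsuppAddEquivProdFinsupp u).1 +
      p (Finsupp.sumFinsuppAddEquivProdFinsupp u).2 := rfl

/-- A superadditive function whose zero set is stable under positive multiples, as for the order
function of a radical monomial ideal. -/
def IsReduced : Prop := ∀ (n : ℕ) s, o s = 0 → o (n • s) = 0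

variable {o p}

lemma IsReduced.prod (ho : o.IsReduced) (hp : p.IsReduced) : (o.prod p).IsReduced := by
  intro n u hu
  rw [prod_apply] at hu ⊢
  rw [map_nsmul, Prod.smul_fst, Prod.smul_snd, ho n _ (by omega), hp n _ (by omega)]

end SuperaddFun

section Filtration

open PaperHTT ConvexModule

variable {k : Type} [Field k] {σ τ : Type}

section Sequence

variable {J : Ideal (MvPolynomial σ k)} {n : ℕ} {S T U : Set (σ →₀ ℕ)}
  [S.OrdConnected] [T.OrdConnected] [U.OrdConnected]

lemma ConvexModule.extVanishing_middle {d : ℕ} (hTS : T ⊆ S) (hUS : U ⊆ S)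
    (hTU : ∀ s ∈ S, s ∈ U ↔ s ∉ T) (hup : ∀ s ∈ U, ∀ t ∈ S, s ≤ t → t ∈ U)
    (hU : ExtVanishing J (ConvexModule k n U) d) (hT : ExtVanishing J (ConvexModule k n T) d) :
    ExtVanishing J (ConvexModule k n S) d := by
  have h1 : ∀ s ∈ U, ∀ t ∈ S, s ≤ t → (s ∈ S ↔ t ∈ U) := fun s hs t ht hst =>
    ⟨fun _ => hup s hs t ht hst, fun _ => hUS hs⟩
  have h2 : ∀ s ∈ S, ∀ t ∈ T, s ≤ t → (s ∈ T ↔ t ∈ S) := fun s hs t ht hst =>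
    ⟨fun _ => hTS ht, fun _ => by
      by_contra hc
      exact (hTU t (hTS ht)).1 (hup s ((hTU s hs).2 hc) t (hTS ht) hst) ht⟩
  exact .middle (res_injective h1 hUS) (res_surjective h2 hTS) (res_exact h1 h2 hTU hTS) hU hT

lemma ConvexModule.extVanishing_left {d : ℕ} (hTS : T ⊆ S) (hUS : U ⊆ S)
    (hTU : ∀ s ∈ S, s ∈ U ↔ s ∉ T) (hup : ∀ s ∈ U, ∀ t ∈ S, s ≤ t → t ∈ U)
    (hS : ExtVanishing J (ConvexModule k n S) d) (hT : ExtVanishing J (ConvexModule k n T) d) :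
    ExtVanishing J (ConvexModule k n U) d := by
  have h1 : ∀ s ∈ U, ∀ t ∈ S, s ≤ t → (s ∈ S ↔ t ∈ U) := fun s hs t ht hst =>
    ⟨fun _ => hup s hs t ht hst, fun _ => hUS hs⟩
  have h2 : ∀ s ∈ S, ∀ t ∈ T, s ≤ t → (s ∈ T ↔ t ∈ S) := fun s hs t ht hst =>
    ⟨fun _ => hTS ht, fun _ => by
      by_contra hc
      exact (hTU t (hTS ht)).1 (hup s ((hTU s hs).2 hc) t (hTS ht) hst) ht⟩
  cases d with
  | zero => exact fun j hj => absurd hj (Nat.not_lt_zero j)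
  | succ d =>
    exact .left (res_injective h1 hUS) (res_surjective h2 hTS) (res_exact h1 h2 hTU hTS) hS
      (hT.mono d.le_succ)

lemma ConvexModule.extVanishing_retract {d : ℕ} (hUS : U ⊆ S)
    (hup : ∀ s ∈ U, ∀ t ∈ S, s ≤ t → t ∈ U) (hdown : ∀ s ∈ S, ∀ t ∈ U, s ≤ t → s ∈ U)
    (hS : ExtVanishing J (ConvexModule k n S) d) : ExtVanishing J (ConvexModule k n U) d := by
  have h1 : ∀ s ∈ U, ∀ t ∈ S, s ≤ t → (s ∈ S ↔ t ∈ U) := fun s hs t ht hst =>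
    ⟨fun _ => hup s hs t ht hst, fun _ => hUS hs⟩
  have h2 : ∀ s ∈ S, ∀ t ∈ U, s ≤ t → (s ∈ U ↔ t ∈ S) := fun s hs t ht hst =>
    ⟨fun _ => hUS ht, fun _ => hdown s hs t ht hst⟩
  refine hS.of_retract (res k n h1) (res k n h2) fun x => ext_coeff fun u => ?_
  simp [res_apply, coeff_resₗ, hUS u.2]

lemma ConvexModule.extVanishing_empty (hS : S = ∅) (d : ℕ) :
    ExtVanishing J (ConvexModule k n S) d := by
  have := subsingleton_of_eq_empty (k := k) (n := n) hS
  exact .of_subsingleton d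

end Sequence

lemma ConvexModule.extVanishing_congr {J : Ideal (MvPolynomial σ k)} {S T : Set (σ →₀ ℕ)}
    [S.OrdConnected] [T.OrdConnected] {n d : ℕ} (h : S = T)
    (hS : ExtVanishing J (ConvexModule k n S) d) : ExtVanishing J (ConvexModule k n T) d := by
  subst h
  exact hS

lemma ConvexModule.regDepth_congr {J : Ideal (MvPolynomial σ k)} {S T : Set (σ →₀ ℕ)}
    [S.OrdConnected] [T.OrdConnected] {n d : ℕ} (h : S = T)
    (hS : RegDepth J d (ConvexModule k n S)) : RegDepth J d (ConvexModule k n T) := by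
  subst h
  exact hS

lemma RegDepth.le_of_extVanishing {R : Type} [CommRing R] {J : Ideal R} {M : Type}
    [AddCommGroup M] [Module R M] {d e : ℕ} (h : RegDepth J e M) (h' : ExtVanishing J M d) :
    d ≤ e := by
  by_contra! hlt
  exact h.extVanishing.2 (h'.mono hlt)

lemma extVanishing_prodExponents [Finite σ] [Finite τ] {S : Set (σ →₀ ℕ)} {T : Set (τ →₀ ℕ)}
    [S.OrdConnected] [T.OrdConnected] {d e : ℕ}
    (hS : ExtVanishing (maxHomIdeal k σ) (ConvexModule k 1 S) d)
    (hT : ExtVanishing (maxHomIdeal k τ) (ConvexModule k 1 T) e) :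
    ExtVanishing (maxHomIdeal k (σ ⊕ τ)) (ConvexModule k 1 (prodExponents S T)) (d + e) := by
  rcases S.eq_empty_or_nonempty with rfl | hS'
  · exact extVanishing_empty (Set.eq_empty_of_forall_notMem fun _ h => h.1) _
  rcases T.eq_empty_or_nonempty with rfl | hT'
  · exact extVanishing_empty (Set.eq_empty_of_forall_notMem fun _ h => h.2) _
  obtain ⟨d', hd'⟩ := ConvexModule.exists_regDepth k one_pos hS'
  obtain ⟨e', he'⟩ := ConvexModule.exists_regDepth k one_pos hT'
  exact (regDepth_prod hd' he').extVanishing.1.mono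
    (add_le_add (hd'.le_of_extVanishing hS) (he'.le_of_extVanishing hT))

namespace SuperaddFun

variable {o : SuperaddFun σ} {p : SuperaddFun τ} {d e : ℕ}

lemma below_zero : o.below 0 = ∅ := Set.eq_empty_of_forall_notMem fun _ hs =>
  Nat.not_lt_zero _ (o.mem_below.1 hs)

/-- The depths of all `below n` are at least `d` if and only if those of all `level n` are. -/
lemma forall_extVanishing_below_iff {J : Ideal (MvPolynomial σ k)} :
    (∀ n, ExtVanishing J (ConvexModule k 1 (o.below n)) d) ↔
      ∀ n, ExtVanishing J (ConvexModule k 1 (o.level n)) d := by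
  have h1 : ∀ n, o.below n ⊆ o.below (n + 1) := fun n s hs => Nat.lt_succ_of_lt hs
  have h2 : ∀ n, o.level n ⊆ o.below (n + 1) := fun n s hs => Nat.lt_succ_of_le hs.le
  have h3 : ∀ n, ∀ s ∈ o.below (n + 1), s ∈ o.level n ↔ s ∉ o.below n := fun n s hs => by
    rw [mem_below] at hs ⊢
    rw [mem_level]
    omega
  have h4 : ∀ n, ∀ s ∈ o.level n, ∀ t ∈ o.below (n + 1), s ≤ t → t ∈ o.level n := by
    intro n s hs t ht hst
    rw [mem_below] at ht
    rw [mem_level] at hs ⊢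
    have := o.mono hst
    omega
  refine ⟨fun h n => extVanishing_left (h1 n) (h2 n) (h3 n) (h4 n) (h _) (h _), fun h n => ?_⟩
  induction n with
  | zero => exact extVanishing_empty below_zero d
  | succ n ih => exact extVanishing_middle (h1 n) (h2 n) (h3 n) (h4 n) (h n) ih

lemma IsReduced.le_depth_one [Finite σ] (ho : o.IsReduced) {n : ℕ} (hn : 0 < n)
    (hd : RegDepth (maxHomIdeal k σ) d (ConvexModule k 1 (o.below n)))
    (he : RegDepth (maxHomIdeal k σ) e (ConvexModule k 1 (o.below 1))) : d ≤ e := by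
  obtain ⟨d', hd'⟩ := ConvexModule.exists_regDepth k hn ⟨0, o.zero_mem_below hn⟩
  obtain rfl := (regDepth_one hn hd').unique hd
  refine he.le_of_extVanishing (extVanishing_of_dilation hn (fun s => ?_) hd'.extVanishing.1)
  rw [mem_below, mem_below, Nat.lt_one_iff]
  refine ⟨fun h => ?_, fun h => by rwa [ho n s h]⟩
  by_contra hs
  have := o.mul_le n s
  have := Nat.le_mul_of_pos_right n (Nat.pos_of_ne_zero hs)
  omega

lemma IsReduced.forall_regDepth_iff [Finite σ] (ho : o.IsReduced)
    (hd : RegDepth (maxHomIdeal k σ) d (ConvexModule k 1 (o.below 1))) :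
    (∀ n, 0 < n → RegDepth (maxHomIdeal k σ) d (ConvexModule k 1 (o.below n))) ↔
      ∀ n, ExtVanishing (maxHomIdeal k σ) (ConvexModule k 1 (o.level n)) d := by
  rw [← forall_extVanishing_below_iff]
  refine ⟨fun h n => ?_, fun h n hn => ?_⟩
  · rcases n.eq_zero_or_pos with rfl | hn
    · exact extVanishing_empty below_zero d
    · exact (h n hn).extVanishing.1
  · obtain ⟨e, he⟩ := ConvexModule.exists_regDepth k one_pos ⟨0, o.zero_mem_below hn⟩
    rwa [le_antisymm (he.le_of_extVanishing (h n)) (ho.le_depth_one hn he hd)]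

lemma regDepth_prod_below_one
    (hd : RegDepth (maxHomIdeal k σ) d (ConvexModule k 1 (o.below 1)))
    (he : RegDepth (maxHomIdeal k τ) e (ConvexModule k 1 (p.below 1))) :
    RegDepth (maxHomIdeal k (σ ⊕ τ)) (d + e) (ConvexModule k 1 ((o.prod p).below 1)) := by
  have : (o.prod p).below 1 = prodExponents (o.below 1) (p.below 1) := by
    ext u
    rw [mem_below, prod_apply]
    exact Nat.lt_one_iff.trans (Nat.add_eq_zero_iff.trans
      (and_congr Nat.lt_one_iff.symm Nat.lt_one_iff.symm))
  exact regDepth_congr this.symm (regDepth_prod hd he)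

lemma extVanishing_level_prod [Finite σ] [Finite τ]
    (ho : ∀ n, ExtVanishing (maxHomIdeal k σ) (ConvexModule k 1 (o.level n)) d)
    (hp : ∀ n, ExtVanishing (maxHomIdeal k τ) (ConvexModule k 1 (p.level n)) e) (n : ℕ) :
    ExtVanishing (maxHomIdeal k (σ ⊕ τ)) (ConvexModule k 1 ((o.prod p).level n)) (d + e) := by
  let π (u : σ ⊕ τ →₀ ℕ) : ℕ := o (Finsupp.sumFinsuppAddEquivProdFinsupp u).1
  have hπ : Monotone π := fun u v h => o.mono (sumFinsuppAddEquivProdFinsupp_mono h).1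
  have hπ' : Monotone fun u : σ ⊕ τ →₀ ℕ => p (Finsupp.sumFinsuppAddEquivProdFinsupp u).2 :=
    fun u v h => p.mono (sumFinsuppAddEquivProdFinsupp_mono h).2
  have hlt : ∀ m, (π ⁻¹' Set.Iio m).OrdConnected := fun m =>
    Set.ordConnected_Iio.preimage_mono hπ
  have key : ∀ m ≤ n + 1, ExtVanishing (maxHomIdeal k (σ ⊕ τ))
      (ConvexModule k 1 ((o.prod p).level n ∩ π ⁻¹' Set.Iio m)) (d + e) := by
    intro m
    induction m with
    | zero =>
      exact fun _ => extVanishing_empty (Set.eq_empty_of_forall_notMem fun s hs =>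
        Nat.not_lt_zero _ hs.2) _
    | succ m ih =>
      intro hm
      refine extVanishing_middle (T := (o.prod p).level n ∩ π ⁻¹' Set.Iio m)
        (U := prodExponents (o.level m) (p.level (n - m))) ?_ ?_ ?_ ?_
        (extVanishing_prodExponents (ho m) (hp (n - m))) (ih (by omega))
      · exact fun u hu => ⟨hu.1, Nat.lt_succ_of_lt hu.2⟩
      · rintro u ⟨h1, h2⟩
        rw [mem_level] at h1 h2
        refine ⟨?_, ?_⟩
        · rw [mem_level, prod_apply, h1, h2]
          omega
        · exact Nat.lt_succ_of_le h1.le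
      · rintro u ⟨h1, h2⟩
        rw [mem_level, prod_apply] at h1
        have h2 : π u < m + 1 := h2
        constructor
        · rintro ⟨h3, -⟩ ⟨-, h4⟩
          exact h4.ne h3
        · intro h3
          have h4 : ¬ π u < m := fun h => h3 ⟨h1, h⟩
          have h5 : π u = m := by omega
          have h6 : π u = o (Finsupp.sumFinsuppAddEquivProdFinsupp u).1 := rfl
          exact ⟨h5, by rw [mem_level]; omega⟩
      · rintro u ⟨h1, h2⟩ v ⟨h3, h4⟩ huv
        rw [mem_level] at h1 h2
        rw [mem_level, prod_apply] at h3
        have h4 : π v < m + 1 := h4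
        have h5 : π u ≤ π v := hπ huv
        have h6 := hπ' huv
        have h7 : π u = o (Finsupp.sumFinsuppAddEquivProdFinsupp u).1 := rfl
        have h8 : π v = o (Finsupp.sumFinsuppAddEquivProdFinsupp v).1 := rfl
        dsimp only at h6
        refine ⟨?_, ?_⟩ <;> rw [mem_level] <;> omega
  have heq : (o.prod p).level n ∩ π ⁻¹' Set.Iio (n + 1) = (o.prod p).level n := by
    refine Set.inter_eq_left.2 fun u hu => ?_
    rw [mem_level, prod_apply] at hu
    exact Nat.lt_succ_of_le ((Nat.le_add_right _ _).trans hu.le)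
  exact extVanishing_congr heq (key (n + 1) le_rfl)

lemma extVanishing_level_left {J : Ideal (MvPolynomial (σ ⊕ τ) k)} {n c : ℕ}
    (h : ExtVanishing J (ConvexModule k 1 ((o.prod p).level n)) c) :
    ExtVanishing J (ConvexModule k 1 (prodExponents (o.level n) (p.below 1))) c := by
  refine extVanishing_retract ?_ ?_ ?_ h
  · rintro u ⟨h1, h2⟩
    rw [mem_level] at h1 ⊢
    rw [mem_below] at h2
    rw [prod_apply]
    omega
  · rintro u ⟨h1, h2⟩ v h3 huv
    rw [mem_level, prod_apply] at h3
    have h4 := o.mono (sumFinsuppAddEquivProdFinsupp_mono huv).1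
    rw [mem_level] at h1
    refine ⟨?_, ?_⟩
    · rw [mem_level]; omega
    · rw [mem_below]; omega
  · rintro u h3 v ⟨h1, h2⟩ huv
    rw [mem_level, prod_apply] at h3
    have h4 := o.mono (sumFinsuppAddEquivProdFinsupp_mono huv).1
    have h5 := p.mono (sumFinsuppAddEquivProdFinsupp_mono huv).2
    rw [mem_level] at h1
    rw [mem_below] at h2
    refine ⟨?_, ?_⟩
    · rw [mem_level]; omega
    · rw [mem_below]; omega

lemma extVanishing_level_right {J : Ideal (MvPolynomial (σ ⊕ τ) k)} {n c : ℕ}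
    (h : ExtVanishing J (ConvexModule k 1 ((o.prod p).level n)) c) :
    ExtVanishing J (ConvexModule k 1 (prodExponents (o.below 1) (p.level n))) c := by
  refine extVanishing_retract ?_ ?_ ?_ h
  · rintro u ⟨h1, h2⟩
    rw [mem_level] at h2 ⊢
    rw [mem_below] at h1
    rw [prod_apply]
    omega
  · rintro u ⟨h1, h2⟩ v h3 huv
    rw [mem_level, prod_apply] at h3
    have h4 := p.mono (sumFinsuppAddEquivProdFinsupp_mono huv).2
    rw [mem_level] at h2
    refine ⟨?_, ?_⟩
    · rw [mem_below]; omega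
    · rw [mem_level]; omega
  · rintro u h3 v ⟨h1, h2⟩ huv
    rw [mem_level, prod_apply] at h3
    have h4 := o.mono (sumFinsuppAddEquivProdFinsupp_mono huv).1
    have h5 := p.mono (sumFinsuppAddEquivProdFinsupp_mono huv).2
    rw [mem_level] at h2
    rw [mem_below] at h1
    refine ⟨?_, ?_⟩
    · rw [mem_below]; omega
    · rw [mem_level]; omega

lemma forall_extVanishing_level_prod_iff [Finite σ] [Finite τ]
    (hd : RegDepth (maxHomIdeal k σ) d (ConvexModule k 1 (o.below 1)))
    (he : RegDepth (maxHomIdeal k τ) e (ConvexModule k 1 (p.below 1))) :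
    (∀ n, ExtVanishing (maxHomIdeal k (σ ⊕ τ)) (ConvexModule k 1 ((o.prod p).level n)) (d + e)) ↔
      (∀ n, ExtVanishing (maxHomIdeal k σ) (ConvexModule k 1 (o.level n)) d) ∧
        ∀ n, ExtVanishing (maxHomIdeal k τ) (ConvexModule k 1 (p.level n)) e := by
  refine ⟨fun h => ⟨fun n => ?_, fun n => ?_⟩, fun h => extVanishing_level_prod h.1 h.2⟩
  · rcases (o.level n).eq_empty_or_nonempty with h0 | h0
    · exact extVanishing_empty h0 d
    obtain ⟨d', hd'⟩ := ConvexModule.exists_regDepth k one_pos h0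
    have := (regDepth_prod hd' he).le_of_extVanishing (extVanishing_level_left (h n))
    exact hd'.extVanishing.1.mono (by omega)
  · rcases (p.level n).eq_empty_or_nonempty with h0 | h0
    · exact extVanishing_empty h0 e
    obtain ⟨e', he'⟩ := ConvexModule.exists_regDepth k one_pos h0
    have := (regDepth_prod hd he').le_of_extVanishing (extVanishing_level_right (h n))
    exact he'.extVanishing.1.mono (by omega)

end SuperaddFun

end Filtration

namespace SuperaddFun

open PaperHTT ConvexModule

variable {σ τ : Type} {k : Type} [Field k] {o : SuperaddFun σ} {p : SuperaddFun τ}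

/-- The monomial ideal spanned by the monomials of order at least `n`. -/
noncomputable def ideal (k : Type) [Field k] (o : SuperaddFun σ) (n : ℕ) :
    Ideal (MvPolynomial σ k) :=
  Ideal.span ((fun a => monomial a (1 : k)) '' {s | n ≤ o s})

lemma mem_ideal {n : ℕ} {f : MvPolynomial σ k} :
    f ∈ o.ideal k n ↔ ∀ s ∈ f.support, n ≤ o s := by
  rw [ideal, mem_ideal_span_monomial_image]
  exact forall₂_congr fun s _ => ⟨fun ⟨t, ht, hts⟩ => le_trans ht (o.mono hts),
    fun h => ⟨s, h, le_rfl⟩⟩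

lemma monomial_mem_ideal {n : ℕ} {s : σ →₀ ℕ} :
    monomial s (1 : k) ∈ o.ideal k n ↔ n ≤ o s := by
  classical
  simp [mem_ideal, support_monomial]

lemma ideal_zero : o.ideal k 0 = ⊤ :=
  Ideal.eq_top_iff_one _ |>.2 (mem_ideal.2 fun _ _ => Nat.zero_le _)

lemma ideal_mul_ideal_le (m n : ℕ) : o.ideal k m * o.ideal k n ≤ o.ideal k (m + n) := by
  rw [ideal, ideal, Ideal.span_mul_span', Ideal.span_le]
  rintro _ ⟨_, ⟨s, hs, rfl⟩, _, ⟨t, ht, rfl⟩, rfl⟩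
  simp only [monomial_mul, mul_one]
  exact monomial_mem_ideal.2 ((add_le_add hs ht).trans (o.add_le s t))

lemma pow_le_ideal {I : Ideal (MvPolynomial σ k)} (hI : I ≤ o.ideal k 1) (n : ℕ) :
    I ^ n ≤ o.ideal k n := by
  induction n with
  | zero => exact le_top.trans (ideal_zero (k := k) (o := o)).ge
  | succ n ih => exact pow_succ I n ▸ (Ideal.mul_mono ih hI).trans (ideal_mul_ideal_le n 1)

/-- `o` computes the `I`-adic order of monomials. -/
def IsOrderOf (o : SuperaddFun σ) (I : Ideal (MvPolynomial σ k)) : Prop :=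
  ∀ n, I ^ n = o.ideal k n

/-- The total degree of an exponent vector. -/
noncomputable def degree (σ : Type) : SuperaddFun σ where
  toFun := Finsupp.degree
  add_le' s t := (map_add Finsupp.degree s t).ge

/-- Proper squarefree monomial ideals have a reduced order function. -/
lemma exists_isOrderOf {I : Ideal (MvPolynomial σ k)} (hI : I ≠ ⊤)
    (hsf : IsSquarefreeMonomialIdeal k I) : ∃ o : SuperaddFun σ, o.IsOrderOf I ∧ o.IsReduced := by
  classical
  obtain ⟨S, hS, hIS⟩ := hsf
  have hdeg : I ≤ (degree σ).ideal k 1 := by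
    rw [hIS, Ideal.span_le]
    rintro _ ⟨s, hs, rfl⟩
    refine monomial_mem_ideal.2 (Nat.one_le_iff_ne_zero.2 fun h => hI ?_)
    rw [Ideal.eq_top_iff_one, hIS]
    obtain rfl : s = 0 := (Finsupp.degree_eq_zero_iff s).1 h
    exact Ideal.subset_span ⟨0, hs, rfl⟩
  let ord (s : σ →₀ ℕ) : ℕ :=
    Nat.findGreatest (fun n => monomial s (1 : k) ∈ I ^ n) s.degree
  have hord : ∀ n s, n ≤ ord s ↔ monomial s (1 : k) ∈ I ^ n := by
    refine fun n s => ⟨fun h => Ideal.pow_le_pow_right h ?_, fun h => ?_⟩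
    · exact Nat.findGreatest_spec (P := fun n => monomial s (1 : k) ∈ I ^ n) (Nat.zero_le _)
        (by simp)
    · exact Nat.le_findGreatest (monomial_mem_ideal.1 (pow_le_ideal hdeg n h)) h
  let o : SuperaddFun σ := ⟨ord, fun s t => by
    rw [hord, pow_add, ← one_mul (1 : k), ← monomial_mul]
    exact Ideal.mul_mem_mul ((hord _ _).1 le_rfl) ((hord _ _).1 le_rfl)⟩
  refine ⟨o, fun n => le_antisymm (pow_le_ideal ?_ n) ?_, fun n s hs => ?_⟩
  · nth_rw 1 [hIS]
    rw [Ideal.span_le]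
    rintro _ ⟨s, hs, rfl⟩
    refine monomial_mem_ideal.2 ((hord 1 s).2 ?_)
    rw [pow_one, hIS]
    exact Ideal.subset_span ⟨s, hs, rfl⟩
  · rw [ideal, Ideal.span_le]
    rintro _ ⟨s, hs, rfl⟩
    exact (hord n s).1 hs
  · by_contra h
    have hmem := (hord 1 _).1 (Nat.one_le_iff_ne_zero.2 h)
    rw [pow_one, hIS, mem_ideal_span_monomial_image] at hmem
    obtain ⟨t, ht, hts⟩ := hmem (n • s) (by simp)
    have hle : t ≤ s := fun x => by
      have h1 := hS t ht x
      have h2 : t x ≤ n * s x := hts x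
      rcases (s x).eq_zero_or_pos with h3 | h3
      · simpa [h3] using h2
      · omega
    have : 1 ≤ ord s := by
      rw [hord, pow_one, hIS, mem_ideal_span_monomial_image]
      intro u hu
      obtain rfl : s = u := by simpa using hu
      exact ⟨t, ht, hle⟩
    exact Nat.one_le_iff_ne_zero.1 this hs

lemma IsOrderOf.prod {I : Ideal (MvPolynomial σ k)} {J : Ideal (MvPolynomial τ k)}
    (hI : o.IsOrderOf I) (hJ : p.IsOrderOf J) :
    (o.prod p).IsOrderOf (I.map (rename Sum.inl : MvPolynomial σ k →ₐ[k] MvPolynomial (σ ⊕ τ) k) +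
      J.map (rename Sum.inr : MvPolynomial τ k →ₐ[k] MvPolynomial (σ ⊕ τ) k)) := by
  refine fun n => le_antisymm (pow_le_ideal ?_ n) ?_
  · refine sup_le ?_ ?_
    · rw [← pow_one I, hI, ideal, Ideal.map_span, Ideal.span_le]
      rintro _ ⟨_, ⟨s, hs, rfl⟩, rfl⟩
      simp only [rename_monomial, SetLike.mem_coe]
      rw [monomial_mem_ideal, prod_apply, sumFinsuppAddEquivProdFinsupp_mapDomain_inl]
      exact le_add_right hs
    · rw [← pow_one J, hJ, ideal, Ideal.map_span, Ideal.span_le]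
      rintro _ ⟨_, ⟨s, hs, rfl⟩, rfl⟩
      simp only [rename_monomial, SetLike.mem_coe]
      rw [monomial_mem_ideal, prod_apply, sumFinsuppAddEquivProdFinsupp_mapDomain_inr]
      exact le_add_left hs
  · rw [ideal, Ideal.span_le]
    rintro _ ⟨u, hu, rfl⟩
    obtain ⟨⟨s, t⟩, rfl⟩ := Finsupp.sumFinsuppAddEquivProdFinsupp.symm.surjective u
    have hu : n ≤ o s + p t := by simpa [prod_apply] using hu
    have h1 : Finsupp.sumFinsuppAddEquivProdFinsupp.symm (s, t) =
        s.mapDomain Sum.inl + t.mapDomain Sum.inr := by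
      rw [AddEquiv.symm_apply_eq, map_add, sumFinsuppAddEquivProdFinsupp_mapDomain_inl,
        sumFinsuppAddEquivProdFinsupp_mapDomain_inr]
      simp
    have h2 : monomial (s.mapDomain Sum.inl + t.mapDomain Sum.inr) (1 : k) =
        rename Sum.inl (monomial s (1 : k)) * rename Sum.inr (monomial t (1 : k)) := by
      rw [rename_monomial, rename_monomial, monomial_mul, one_mul]
    have h3 : monomial s (1 : k) ∈ I ^ o s := by
      rw [hI]
      exact monomial_mem_ideal.2 le_rfl
    have h4 : monomial t (1 : k) ∈ J ^ p t := by
      rw [hJ]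
      exact monomial_mem_ideal.2 le_rfl
    refine Ideal.pow_le_pow_right hu ?_
    simp only [h1, h2, pow_add]
    refine Ideal.mul_mem_mul (Ideal.pow_right_mono le_sup_left _ ?_)
      (Ideal.pow_right_mono le_sup_right _ ?_)
    · rw [← Ideal.map_pow]
      exact Ideal.mem_map_of_mem _ h3
    · rw [← Ideal.map_pow]
      exact Ideal.mem_map_of_mem _ h4

lemma smul_term_zero {n : ℕ} (hn : 0 < n) (f : MvPolynomial σ k) (s : o.below n) :
    ConvexModule.coeff s (f • term k 1 (o.below n) 0 1) = MvPolynomial.coeff s f := by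
  classical
  induction f using MvPolynomial.induction_on' with
  | monomial u a =>
    rw [monomial_smul_term _ _ (o.zero_mem_below hn), coeff_term, coeff_monomial]
    simp
  | add f g hf hg => rw [add_smul, _root_.map_add, hf, hg, MvPolynomial.coeff_add]

/-- The quotient by `o.ideal k n` has the monomials of order less than `n` as a basis. -/
lemma nonempty_quotient_equiv {n : ℕ} (hn : 0 < n) :
    Nonempty ((MvPolynomial σ k ⧸ o.ideal k n) ≃ₗ[MvPolynomial σ k]
      ConvexModule k 1 (o.below n)) := by
  let φ := LinearMap.toSpanSingleton (MvPolynomial σ k) _ (term k 1 (o.below n) 0 1)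
  have hker : LinearMap.ker φ = o.ideal k n := by
    ext f
    rw [LinearMap.mem_ker, LinearMap.toSpanSingleton_apply, mem_ideal]
    refine ⟨fun h s hs => ?_, fun h => ext_coeff fun s => ?_⟩
    · by_contra! hlt
      have := smul_term_zero hn f ⟨s, hlt⟩
      rw [h, _root_.map_zero] at this
      exact mem_support_iff.1 hs this.symm
    · rw [smul_term_zero hn, _root_.map_zero]
      by_contra hs
      exact (o.mem_below.1 s.2).not_ge (h s (mem_support_iff.2 hs))
  have hsurj : Function.Surjective φ := by
    intro x
    induction x using ConvexModule.induction with
    | zero => exact ⟨0, _root_.map_zero φ⟩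
    | add x y hx hy =>
      obtain ⟨f, rfl⟩ := hx
      obtain ⟨g, rfl⟩ := hy
      exact ⟨f + g, _root_.map_add φ f g⟩
    | term s hs c =>
      refine ⟨monomial s c, ?_⟩
      rw [LinearMap.toSpanSingleton_apply, monomial_smul_term _ _ (o.zero_mem_below hn)]
      simp
  exact ⟨(Submodule.quotEquivOfEq _ _ hker.symm).trans (φ.quotKerEquivOfSurjective hsurj)⟩

variable {I : Ideal (MvPolynomial σ k)} {d : ℕ}

lemma IsOrderOf.depthQuot_eq [Finite σ] (h : o.IsOrderOf I) {n : ℕ} (hn : 0 < n)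
    (hd : RegDepth (maxHomIdeal k σ) d (ConvexModule k 1 (o.below n))) :
    depthQuot k (I ^ n) = d := by
  obtain ⟨e⟩ := nonempty_quotient_equiv (k := k) (o := o) hn
  rw [h n]
  have hd' := (hd.of_equiv e.symm).extVanishing
  refine depthM_eq (fun htop => ?_) hd'.1 hd'.2
  refine ConvexModule.smul_top_ne_top (k := k) (n := 1) one_pos ⟨0, o.zero_mem_below hn⟩ ?_
  have := congrArg (Submodule.map e.toLinearMap) htop
  rwa [Submodule.map_smul'', Submodule.map_top, LinearEquiv.range] at this

lemma IsOrderOf.forall_depthQuot_eq_iff [Finite σ] (h : o.IsOrderOf I) (ho : o.IsReduced)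
    (hd : RegDepth (maxHomIdeal k σ) d (ConvexModule k 1 (o.below 1))) :
    (∀ n, 1 ≤ n → depthQuot k (I ^ n) = depthQuot k I) ↔
      ∀ n, ExtVanishing (maxHomIdeal k σ) (ConvexModule k 1 (o.level n)) d := by
  have h1 : depthQuot k I = d := by rw [← pow_one I, h.depthQuot_eq one_pos hd]
  rw [← ho.forall_regDepth_iff hd, h1]
  refine forall₂_congr fun n hn => ⟨fun hn' => ?_, fun hn' => h.depthQuot_eq hn hn'⟩
  obtain ⟨e, he⟩ := ConvexModule.exists_regDepth k one_pos ⟨0, o.zero_mem_below hn⟩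
  rwa [← hn', h.depthQuot_eq hn he]

end SuperaddFun

open PaperHTT in
/-- Proposition 4.7: for squarefree monomial ideals `I` and `J`, the ideal `I + J` has a
constant depth function if and only if both `I` and `J` have constant depth functions. -/
theorem constant_depth_function_sum_iff
    (k : Type) [Field k] (r s : ℕ)
    (I : Ideal (PA k r)) (J : Ideal (PB k s))
    (hI0 : I ≠ ⊥) (hI1 : I ≠ ⊤) (hIsf : IsSquarefreeMonomialIdeal k I)
    (hJ0 : J ≠ ⊥) (hJ1 : J ≠ ⊤) (hJsf : IsSquarefreeMonomialIdeal k J) :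
    (∀ n : ℕ, 1 ≤ n → depthQuot k ((sumIJ k I J) ^ n) = depthQuot k (sumIJ k I J)) ↔
      ((∀ n : ℕ, 1 ≤ n → depthQuot k (I ^ n) = depthQuot k I) ∧
        (∀ n : ℕ, 1 ≤ n → depthQuot k (J ^ n) = depthQuot k J)) := by
  obtain ⟨o, hI, ho⟩ := SuperaddFun.exists_isOrderOf hI1 hIsf
  obtain ⟨p, hJ, hp⟩ := SuperaddFun.exists_isOrderOf hJ1 hJsf
  obtain ⟨d, hd⟩ := ConvexModule.exists_regDepth k one_pos ⟨0, o.zero_mem_below one_pos⟩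
  obtain ⟨e, he⟩ := ConvexModule.exists_regDepth k one_pos ⟨0, p.zero_mem_below one_pos⟩
  rw [hI.forall_depthQuot_eq_iff ho hd, hJ.forall_depthQuot_eq_iff hp he,
    ← SuperaddFun.forall_extVanishing_level_prod_iff hd he]
  exact (hI.prod hJ).forall_depthQuot_eq_iff (ho.prod hp)
    (SuperaddFun.regDepth_prod_below_one hd he)
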